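/- arXiv:1808.10419 — 12 statements merged into one kernel-verified Lean document; each statement's English description precedes it below -/
import Mathlib

section
/- Suppose the conic MIP is feasible, i.e., there exist x ∈ ℤ^{n₁} and y ∈ ℝ^{n₂} with Ax + Gy − b ∈ K, and suppose its subadditive dual is feasible, i.e., there exists at least one function feasible for the subadditive dual. Then the subadditive dual is a strong dual: the primal optimal value z* is finite, every dual feasible f satisfies f(b) ≤ z*, and there exists a dual feasible function f* with f*(b) = z* (so the dual supremum equals z* and is attained). -/
/-!
STATEMENT 0: If the conic MIP and its subadditive dual are both feasible, then the
subadditive dual is a strong dual: the primal optimal value `z*` is finite, every dual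
feasible `f` satisfies `f b ≤ z*`, and some dual feasible `f*` attains `f* b = z*`.
-/

/-- A regular cone: closed, convex, closed under nonnegative scaling,
pointed (`K ∩ (-K) = {0}`) and full-dimensional (nonempty interior). -/
def IsRegularCone {m : ℕ} (K : Set (Fin m → ℝ)) : Prop :=
  IsClosed K ∧ Convex ℝ K ∧ (∀ x ∈ K, ∀ t : ℝ, 0 ≤ t → t • x ∈ K) ∧
    K ∩ (-K) = {0} ∧ (interior K).Nonempty

/-- `f̄ w = limsup_{δ → 0⁺} f (δ w) / δ`, in the extended reals. -/
noncomputable def fbar {m : ℕ} (f : (Fin m → ℝ) → ℝ) (w : Fin m → ℝ) : EReal :=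
  Filter.limsup (fun δ : ℝ => ((f (δ • w) / δ : ℝ) : EReal)) (nhdsWithin 0 (Set.Ioi 0))

/-- Feasibility of `f` for the subadditive dual of the conic MIP
`inf {c·x + d·y : A x + G y - b ∈ K, x ∈ ℤ^{n₁}, y ∈ ℝ^{n₂}}`:
`f` is subadditive, nondecreasing with respect to `K`, `f 0 = 0`,
`f(A^j) = -f(-A^j) = c_j` and `f̄(G^j) = -f̄(-G^j) = d_j`. -/
def DualFeasible {m n1 n2 : ℕ} (K : Set (Fin m → ℝ))
    (A : Matrix (Fin m) (Fin n1) ℝ) (G : Matrix (Fin m) (Fin n2) ℝ)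
    (c : Fin n1 → ℝ) (d : Fin n2 → ℝ) (f : (Fin m → ℝ) → ℝ) : Prop :=
  (∀ u v, f (u + v) ≤ f u + f v) ∧
  (∀ u v, u - v ∈ K → f v ≤ f u) ∧
  f 0 = 0 ∧
  (∀ j, f (fun i => A i j) = c j ∧ f (fun i => -A i j) = -c j) ∧
  (∀ j, fbar f (fun i => G i j) = ((d j : ℝ) : EReal) ∧
        fbar f (fun i => -G i j) = ((-d j : ℝ) : EReal))

/-- The set of objective values of primal feasible solutions of the conic MIP. -/
def PrimalValues {m n1 n2 : ℕ} (K : Set (Fin m → ℝ))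
    (A : Matrix (Fin m) (Fin n1) ℝ) (G : Matrix (Fin m) (Fin n2) ℝ)
    (b : Fin m → ℝ) (c : Fin n1 → ℝ) (d : Fin n2 → ℝ) : Set ℝ :=
  {v | ∃ (x : Fin n1 → ℤ) (y : Fin n2 → ℝ),
    A.mulVec (fun i => (x i : ℝ)) + G.mulVec y - b ∈ K ∧
    v = (∑ i, c i * (x i : ℝ)) + ∑ j, d j * y j}

theorem nsmul_le_of_subadditive {E : Type*} [AddCommGroup E] {f : E → ℝ}
    (hadd : ∀ u v, f (u + v) ≤ f u + f v) (h0 : f 0 = 0) (v : E) (n : ℕ) :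
    f (n • v) ≤ n * f v := by
  induction n with
  | zero => simp [h0]
  | succ k ih =>
    rw [succ_nsmul]
    push_cast
    linarith [hadd (k • v) v]

/-- A subadditive function vanishing at `0` that is odd at `w` is at most linear on `ℤ • w`. -/
theorem zsmul_le_of_subadditive {E : Type*} [AddCommGroup E] {f : E → ℝ}
    (hadd : ∀ u v, f (u + v) ≤ f u + f v) (h0 : f 0 = 0) {w : E} {a : ℝ}
    (hpos : f w = a) (hneg : f (-w) = -a) (z : ℤ) : f (z • w) ≤ a * z := by
  obtain ⟨n, rfl | rfl⟩ := z.eq_nat_or_neg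
  · simpa [hpos, mul_comm] using nsmul_le_of_subadditive hadd h0 w n
  · simpa [hneg, mul_comm] using nsmul_le_of_subadditive hadd h0 (-w) n

/-- A subadditive function is bounded along a ray by its upper directional derivative at `0`. -/
theorem smul_le_of_fbar_eq {m : ℕ} {f : (Fin m → ℝ) → ℝ}
    (hadd : ∀ u v, f (u + v) ≤ f u + f v) (h0 : f 0 = 0) {w : Fin m → ℝ} {a : ℝ}
    (hw : fbar f w = (a : EReal)) {t : ℝ} (ht : 0 < t) : f (t • w) ≤ a * t := by
  have htend : Filter.Tendsto (fun n : ℕ => t / ((n : ℝ) + 1)) Filter.atTop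
      (nhdsWithin 0 (Set.Ioi 0)) := by
    refine tendsto_nhdsWithin_iff.2 ⟨?_, Filter.Eventually.of_forall fun n => ?_⟩
    · simpa [div_eq_mul_inv] using
        (tendsto_one_div_add_atTop_nhds_zero_nat (𝕜 := ℝ)).const_mul t
    · exact Set.mem_Ioi.2 (by positivity)
  have hle : ((f (t • w) / t : ℝ) : EReal) ≤ fbar f w := by
    refine Filter.le_limsup_of_frequently_le (htend.frequently
      (Filter.Eventually.of_forall fun n => ?_).frequently)
    have hn : (0 : ℝ) < (n : ℝ) + 1 := by positivity
    have h := nsmul_le_of_subadditive hadd h0 ((t / ((n : ℝ) + 1)) • w) (n + 1)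
    have hs : (n + 1) • ((t / ((n : ℝ) + 1)) • w) = t • w := by
      rw [← Nat.cast_smul_eq_nsmul ℝ, smul_smul]
      congr 1
      push_cast
      field_simp
    rw [hs, Nat.cast_add_one] at h
    rw [EReal.coe_le_coe_iff, div_le_div_iff₀ ht (by positivity)]
    calc f (t • w) * (t / ((n : ℝ) + 1))
        ≤ (((n : ℝ) + 1) * f ((t / ((n : ℝ) + 1)) • w)) * (t / ((n : ℝ) + 1)) := by gcongr
      _ = f ((t / ((n : ℝ) + 1)) • w) * t := by field_simp
  rw [hw, EReal.coe_le_coe_iff, div_le_iff₀ ht] at hle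
  exact hle

theorem fbar_eq_of_forall_pos {m : ℕ} {f : (Fin m → ℝ) → ℝ} {w : Fin m → ℝ} {a : ℝ}
    (h : ∀ t : ℝ, 0 < t → f (t • w) = a * t) : fbar f w = (a : EReal) := by
  have hev : (fun δ : ℝ => ((f (δ • w) / δ : ℝ) : EReal)) =ᶠ[nhdsWithin 0 (Set.Ioi 0)]
      fun _ => (a : EReal) := by
    filter_upwards [self_mem_nhdsWithin] with δ hδ
    rw [h δ hδ, mul_div_cancel_right₀ a (ne_of_gt hδ)]
  rw [fbar, Filter.limsup_congr hev, Filter.limsup_const]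

/-- The left-hand side `(x, y) ↦ A x + G y` of the conic constraint, as an additive map. -/
noncomputable def constraintMap {m n1 n2 : ℕ} (A : Matrix (Fin m) (Fin n1) ℝ)
    (G : Matrix (Fin m) (Fin n2) ℝ) : (Fin n1 → ℤ) × (Fin n2 → ℝ) →+ (Fin m → ℝ) where
  toFun p := A.mulVec (fun i => (p.1 i : ℝ)) + G.mulVec p.2
  map_zero' := by
    ext i
    simp [Matrix.mulVec, dotProduct]
  map_add' p q := by
    ext i
    simp only [Matrix.mulVec, dotProduct, Pi.add_apply, Prod.fst_add, Prod.snd_add,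
      Int.cast_add, mul_add, Finset.sum_add_distrib]
    ring

/-- The objective `(x, y) ↦ c · x + d · y`, as an additive map. -/
noncomputable def objectiveMap {n1 n2 : ℕ} (c : Fin n1 → ℝ) (d : Fin n2 → ℝ) :
    (Fin n1 → ℤ) × (Fin n2 → ℝ) →+ ℝ where
  toFun p := (∑ i, c i * (p.1 i : ℝ)) + ∑ j, d j * p.2 j
  map_zero' := by simp
  map_add' p q := by
    simp only [Pi.add_apply, Prod.fst_add, Prod.snd_add, Int.cast_add, mul_add,
      Finset.sum_add_distrib]
    ring

theorem constraintMap_single_int {m n1 n2 : ℕ} (A : Matrix (Fin m) (Fin n1) ℝ)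
    (G : Matrix (Fin m) (Fin n2) ℝ) (j : Fin n1) :
    constraintMap A G (Pi.single j 1, 0) = fun i => A i j := by
  ext i
  simp [constraintMap, Matrix.mulVec, dotProduct, Pi.single_apply]

theorem constraintMap_single_real {m n1 n2 : ℕ} (A : Matrix (Fin m) (Fin n1) ℝ)
    (G : Matrix (Fin m) (Fin n2) ℝ) (j : Fin n2) (t : ℝ) :
    constraintMap A G (0, Pi.single j t) = t • fun i => G i j := by
  ext i
  simp [constraintMap, Matrix.mulVec, dotProduct]

theorem objectiveMap_single_int {n1 n2 : ℕ} (c : Fin n1 → ℝ) (d : Fin n2 → ℝ) (j : Fin n1) :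
    objectiveMap c d (Pi.single j 1, 0) = c j := by
  simp [objectiveMap, Pi.single_apply]

theorem objectiveMap_single_real {n1 n2 : ℕ} (c : Fin n1 → ℝ) (d : Fin n2 → ℝ) (j : Fin n2)
    (t : ℝ) : objectiveMap c d (0, Pi.single j t) = d j * t := by
  simp [objectiveMap, Pi.single_apply]

/-- Dual feasible functions are bounded by the objective on the image of the constraint map. -/
theorem DualFeasible.apply_constraintMap_le {m n1 n2 : ℕ} {K : Set (Fin m → ℝ)}
    {A : Matrix (Fin m) (Fin n1) ℝ} {G : Matrix (Fin m) (Fin n2) ℝ}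
    {c : Fin n1 → ℝ} {d : Fin n2 → ℝ} {f : (Fin m → ℝ) → ℝ}
    (hf : DualFeasible K A G c d f) (p : (Fin n1 → ℤ) × (Fin n2 → ℝ)) :
    f (constraintMap A G p) ≤ objectiveMap c d p := by
  obtain ⟨hadd, -, h0, hA, hG⟩ := hf
  have hp : constraintMap A G p =
      (∑ j, p.1 j • fun i => A i j) + ∑ j, p.2 j • fun i => G i j := by
    ext i
    simp [constraintMap, Matrix.mulVec, dotProduct, mul_comm]
  rw [hp]
  refine (hadd _ _).trans (add_le_add ?_ ?_)
  · refine (Finset.le_sum_of_subadditive f h0.le hadd _ _).trans (Finset.sum_le_sum fun j _ => ?_)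
    exact zsmul_le_of_subadditive hadd h0 (hA j).1 (hA j).2 (p.1 j)
  · refine (Finset.le_sum_of_subadditive f h0.le hadd _ _).trans (Finset.sum_le_sum fun j _ => ?_)
    rcases lt_trichotomy (p.2 j) 0 with h | h | h
    · have := smul_le_of_fbar_eq hadd h0 (hG j).2 (neg_pos.2 h)
      have hs : (-p.2 j) • (fun i => -G i j) = p.2 j • fun i => G i j := by
        ext i
        simp
      rw [hs] at this
      linarith
    · simp [h, h0]
    · exact smul_le_of_fbar_eq hadd h0 (hG j).1 h

/-- Dual feasibility says that `f` agrees with the objective on the image of the constraint map. -/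
theorem dualFeasible_iff {m n1 n2 : ℕ} {K : Set (Fin m → ℝ)}
    {A : Matrix (Fin m) (Fin n1) ℝ} {G : Matrix (Fin m) (Fin n2) ℝ}
    {c : Fin n1 → ℝ} {d : Fin n2 → ℝ} {f : (Fin m → ℝ) → ℝ} :
    DualFeasible K A G c d f ↔ (∀ u v, f (u + v) ≤ f u + f v) ∧
      (∀ u v, u - v ∈ K → f v ≤ f u) ∧
      ∀ p, f (constraintMap A G p) = objectiveMap c d p := by
  constructor
  · intro hf
    refine ⟨hf.1, hf.2.1, fun p => (hf.apply_constraintMap_le p).antisymm ?_⟩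
    have h1 := hf.apply_constraintMap_le (-p)
    have h2 := hf.1 (constraintMap A G p) (-constraintMap A G p)
    rw [add_neg_cancel, hf.2.2.1] at h2
    rw [map_neg, map_neg] at h1
    linarith
  · rintro ⟨hadd, hmono, hlin⟩
    refine ⟨hadd, hmono, by simpa using hlin 0, fun j => ?_, fun j => ?_⟩
    · have h1 := hlin (Pi.single j 1, 0)
      have h2 := hlin (-(Pi.single j 1, 0))
      rw [map_neg, map_neg] at h2
      rw [constraintMap_single_int, objectiveMap_single_int] at h1 h2
      exact ⟨h1, h2⟩
    · have key : ∀ t : ℝ, f (t • fun i => G i j) = d j * t := fun t => by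
        rw [← constraintMap_single_real A G j t, hlin, objectiveMap_single_real]
      refine ⟨fbar_eq_of_forall_pos fun t _ => key t, fbar_eq_of_forall_pos fun t _ => ?_⟩
      have hs : (t • fun i => -G i j) = (-t) • fun i => G i j := by
        ext i
        simp
      rw [hs, key]
      ring

/-- The infimal convolution `u ↦ inf_p (L p + h (u - T p))` of the objective `L`, transported
along the constraint map `T`, with a penalty `h`. -/
noncomputable def penalizedValue {P E : Type*} [AddCommGroup P] [AddCommGroup E]
    (T : P →+ E) (L : P →+ ℝ) (h : E → ℝ) (u : E) : ℝ :=
  ⨅ p, (L p + h (u - T p))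

section PenalizedValue

variable {P E : Type*} [AddCommGroup P] [AddCommGroup E] {T : P →+ E} {L : P →+ ℝ}
  {f h : E → ℝ}

theorem le_add_of_subadditive_minorant (hadd : ∀ u v, f (u + v) ≤ f u + f v)
    (hlin : ∀ p, f (T p) = L p) (hfh : ∀ u, f u ≤ h u) (u : E) (p : P) :
    f u ≤ L p + h (u - T p) := by
  have h1 := hadd (T p) (u - T p)
  rw [add_sub_cancel, hlin] at h1
  linarith [hfh (u - T p)]

theorem penalizedValue_le (hadd : ∀ u v, f (u + v) ≤ f u + f v)
    (hlin : ∀ p, f (T p) = L p) (hfh : ∀ u, f u ≤ h u) (u : E) (p : P) :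
    penalizedValue T L h u ≤ L p + h (u - T p) :=
  ciInf_le ⟨f u, Set.forall_mem_range.2 (le_add_of_subadditive_minorant hadd hlin hfh u)⟩ p

theorem penalizedValue_add_le (hadd : ∀ u v, f (u + v) ≤ f u + f v)
    (hlin : ∀ p, f (T p) = L p) (hfh : ∀ u, f u ≤ h u)
    (hhadd : ∀ u v, h (u + v) ≤ h u + h v) (u v : E) :
    penalizedValue T L h (u + v) ≤ penalizedValue T L h u + penalizedValue T L h v := by
  refine le_ciInf_add_ciInf fun p q => ?_
  have h1 := penalizedValue_le hadd hlin hfh (u + v) (p + q)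
  have h2 := hhadd (u - T p) (v - T q)
  rw [map_add, map_add, add_sub_add_comm] at h1
  linarith

theorem penalizedValue_map (hadd : ∀ u v, f (u + v) ≤ f u + f v)
    (hlin : ∀ p, f (T p) = L p) (hfh : ∀ u, f u ≤ h u) (h0 : h 0 = 0) (p : P) :
    penalizedValue T L h (T p) = L p := by
  apply le_antisymm
  · simpa [h0] using penalizedValue_le hadd hlin hfh (T p) p
  · rw [← hlin p]
    exact le_ciInf (le_add_of_subadditive_minorant hadd hlin hfh (T p))

end PenalizedValue

open Classical in
/-- The positive part of `f` plus the fixed cost `M` of leaving `-K`. -/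
noncomputable def jumpPenalty {E : Type*} [AddCommGroup E] (K : Set E) (f : E → ℝ) (M : ℝ)
    (u : E) : ℝ :=
  max (f u) 0 + if -u ∈ K then 0 else M

section JumpPenalty

variable {E : Type*} [AddCommGroup E] {K : Set E} {f : E → ℝ} {M : ℝ}

theorem le_jumpPenalty (hM : 0 ≤ M) (u : E) : f u ≤ jumpPenalty K f M u := by
  unfold jumpPenalty
  split_ifs <;> linarith [le_max_left (f u) 0]

theorem jumpPenalty_add_le (hK : ∀ u ∈ K, ∀ v ∈ K, u + v ∈ K) (hM : 0 ≤ M)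
    (hadd : ∀ u v, f (u + v) ≤ f u + f v) (u v : E) :
    jumpPenalty K f M (u + v) ≤ jumpPenalty K f M u + jumpPenalty K f M v := by
  have hmax : max (f (u + v)) 0 ≤ max (f u) 0 + max (f v) 0 :=
    max_le ((hadd u v).trans (add_le_add (le_max_left _ _) (le_max_left _ _)))
      (add_nonneg (le_max_right _ _) (le_max_right _ _))
  have hmem : -u ∈ K → -v ∈ K → -(u + v) ∈ K := fun hu hv => by
    rw [neg_add]
    exact hK _ hu _ hv
  unfold jumpPenalty
  split_ifs <;> first | linarith | tauto

theorem jumpPenalty_mono (hK : ∀ u ∈ K, ∀ v ∈ K, u + v ∈ K) (hM : 0 ≤ M)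
    (hmono : ∀ u v, u - v ∈ K → f v ≤ f u) (u v : E) (huv : u - v ∈ K) :
    jumpPenalty K f M v ≤ jumpPenalty K f M u := by
  have hmax : max (f v) 0 ≤ max (f u) 0 := max_le_max_right 0 (hmono u v huv)
  have hmem : -u ∈ K → -v ∈ K := fun hu => by
    have := hK _ hu _ huv
    rwa [show -u + (u - v) = -v by abel] at this
  unfold jumpPenalty
  split_ifs <;> first | linarith | tauto

theorem jumpPenalty_eq_zero (h0 : f 0 = 0) (hmono : ∀ u v, u - v ∈ K → f v ≤ f u) {u : E}
    (hu : -u ∈ K) : jumpPenalty K f M u = 0 := by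
  have : f u ≤ 0 := h0 ▸ hmono 0 u (by simpa using hu)
  simp [jumpPenalty, hu, this]

theorem add_le_jumpPenalty {u : E} (hu : -u ∉ K) : f u + M ≤ jumpPenalty K f M u := by
  simp [jumpPenalty, hu]

end JumpPenalty

theorem IsRegularCone.zero_mem {m : ℕ} {K : Set (Fin m → ℝ)} (hK : IsRegularCone K) :
    (0 : Fin m → ℝ) ∈ K :=
  (hK.2.2.2.1.symm ▸ Set.mem_singleton 0 : (0 : Fin m → ℝ) ∈ K ∩ -K).1

theorem IsRegularCone.add_mem {m : ℕ} {K : Set (Fin m → ℝ)} (hK : IsRegularCone K) :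
    ∀ u ∈ K, ∀ v ∈ K, u + v ∈ K := by
  intro u hu v hv
  have hmid : (1 / 2 : ℝ) • u + (1 / 2 : ℝ) • v ∈ K :=
    hK.2.1 hu hv (by norm_num) (by norm_num) (by norm_num)
  simpa [smul_smul] using hK.2.2.1 _ hmid 2 (by norm_num)

theorem subadditive_dual_strong_of_primal_dual_feasible
    {m n1 n2 : ℕ} (K : Set (Fin m → ℝ))
    (A : Matrix (Fin m) (Fin n1) ℝ) (G : Matrix (Fin m) (Fin n2) ℝ)
    (b : Fin m → ℝ) (c : Fin n1 → ℝ) (d : Fin n2 → ℝ)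
    (hK : IsRegularCone K)
    (hprimal : ∃ (x : Fin n1 → ℤ) (y : Fin n2 → ℝ),
      A.mulVec (fun i => (x i : ℝ)) + G.mulVec y - b ∈ K)
    (hdual : ∃ f, DualFeasible K A G c d f) :
    ∃ zstar : ℝ, IsGLB (PrimalValues K A G b c d) zstar ∧
      (∀ f, DualFeasible K A G c d f → f b ≤ zstar) ∧
      (∃ f, DualFeasible K A G c d f ∧ f b = zstar) := by
  have weak : ∀ f, DualFeasible K A G c d f → f b ∈ lowerBounds (PrimalValues K A G b c d) := by
    rintro f hf _ ⟨x, y, hxy, rfl⟩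
    exact (hf.2.1 _ _ hxy).trans (hf.apply_constraintMap_le (x, y))
  obtain ⟨f, hf⟩ := hdual
  obtain ⟨x₀, y₀, h₀⟩ := hprimal
  have hne : (PrimalValues K A G b c d).Nonempty := ⟨_, x₀, y₀, h₀, rfl⟩
  obtain ⟨z, hz⟩ : ∃ z, IsGLB (PrimalValues K A G b c d) z :=
    ⟨_, isGLB_csInf hne ⟨f b, weak f hf⟩⟩
  have hM : 0 ≤ z - f b := sub_nonneg.2 (hz.2 (weak f hf))
  obtain ⟨hadd, hmono, hlin⟩ := dualFeasible_iff.1 hf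
  have h0 : f 0 = 0 := hf.2.2.1
  have hfh := le_jumpPenalty (K := K) (f := f) hM
  set h := jumpPenalty K f (z - f b)
  have hstar : DualFeasible K A G c d
      (penalizedValue (constraintMap A G) (objectiveMap c d) h) := by
    refine dualFeasible_iff.2 ⟨penalizedValue_add_le hadd hlin hfh
      (jumpPenalty_add_le hK.add_mem hM hadd), fun u v huv => le_ciInf fun p => ?_,
      penalizedValue_map hadd hlin hfh
        (jumpPenalty_eq_zero h0 hmono (by simpa using hK.zero_mem))⟩
    refine (penalizedValue_le hadd hlin hfh v p).trans ?_
    gcongr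
    exact jumpPenalty_mono hK.add_mem hM hmono _ _ (by simpa using huv)
  refine ⟨z, hz, fun g hg => hz.2 (weak g hg), _, hstar,
    (hz.2 (weak _ hstar)).antisymm (le_ciInf fun p => ?_)⟩
  by_cases hp : -(b - constraintMap A G p) ∈ K
  · rw [show h _ = 0 from jumpPenalty_eq_zero h0 hmono hp, add_zero]
    rw [neg_sub] at hp
    exact hz.1 ⟨p.1, p.2, hp, rfl⟩
  · have h1 : f _ + (z - f b) ≤ h _ := add_le_jumpPenalty hp
    have h2 := hadd (constraintMap A G p) (b - constraintMap A G p)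
    rw [add_sub_cancel, hlin] at h2
    linarith
end

section
/- Suppose the conic MIP is feasible, i.e., there exist x ∈ ℤ^{n₁} and y ∈ ℝ^{n₂} with Ax + Gy − b ∈ K, and suppose the conic dual of its continuous relaxation is feasible, i.e., there exists λ ∈ K* with Aᵀλ = c and Gᵀλ = d, where K* = {λ ∈ ℝ^m : λ·u ≥ 0 for all u ∈ K} is the dual cone of K. Then the subadditive dual is a strong dual: z* is finite, every dual feasible f satisfies f(b) ≤ z*, and there exists a dual feasible function f* with f*(b) = z*. -/
section

open scoped Matrix
open Filter

variable {m n1 n2 : ℕ} {K : Set (Fin m → ℝ)}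
  {A : Matrix (Fin m) (Fin n1) ℝ} {G : Matrix (Fin m) (Fin n2) ℝ}
  {c : Fin n1 → ℝ} {d : Fin n2 → ℝ}

namespace IsRegularCone

theorem zero_mem_s1 (hK : IsRegularCone K) : (0 : Fin m → ℝ) ∈ K := by
  have h : (0 : Fin m → ℝ) ∈ K ∩ -K := by
    rw [hK.2.2.2.1]
    rfl
  exact h.1

theorem add_mem_s1 (hK : IsRegularCone K) {u v : Fin m → ℝ} (hu : u ∈ K) (hv : v ∈ K) :
    u + v ∈ K := by
  have h : (1 / 2 : ℝ) • u + (1 / 2 : ℝ) • v ∈ K :=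
    hK.2.1 hu hv (by norm_num) (by norm_num) (by norm_num)
  have h2 := hK.2.2.1 _ h 2 (by norm_num)
  rwa [← smul_add, smul_smul, mul_one_div_cancel two_ne_zero, one_smul] at h2

end IsRegularCone

namespace PrimalValues

theorem mem_of_eq (h0 : (0 : Fin m → ℝ) ∈ K) (x : Fin n1 → ℤ) (y : Fin n2 → ℝ)
    {u : Fin m → ℝ} {v : ℝ} (hu : A *ᵥ (fun i => (x i : ℝ)) + G *ᵥ y = u)
    (hv : c ⬝ᵥ (fun i => (x i : ℝ)) + d ⬝ᵥ y = v) : v ∈ PrimalValues K A G u c d :=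
  ⟨x, y, by rwa [hu, sub_self], hv.symm⟩

theorem zero_mem_s1 (h0 : (0 : Fin m → ℝ) ∈ K) : (0 : ℝ) ∈ PrimalValues K A G 0 c d := by
  have h : (fun i => (((0 : Fin n1 → ℤ) i : ℤ) : ℝ)) = 0 := by ext; simp
  exact mem_of_eq h0 0 0 (by rw [h]; simp) (by simp)

theorem intCol_mem (h0 : (0 : Fin m → ℝ) ∈ K) (j : Fin n1) (k : ℤ) :
    k * c j ∈ PrimalValues K A G (fun i => k * A i j) c d := by
  have h : (fun i => ((Pi.single j k : Fin n1 → ℤ) i : ℝ)) = Pi.single j (k : ℝ) := by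
    ext i
    by_cases hij : i = j
    · subst hij; simp
    · simp [hij]
  refine mem_of_eq h0 (Pi.single j k) 0 ?_ ?_
  · rw [h]
    ext i
    simp [mul_comm]
  · rw [h]
    simp [mul_comm]

theorem realCol_mem (h0 : (0 : Fin m → ℝ) ∈ K) (j : Fin n2) (t : ℝ) :
    t * d j ∈ PrimalValues K A G (fun i => t * G i j) c d := by
  have h : (fun i => (((0 : Fin n1 → ℤ) i : ℤ) : ℝ)) = 0 := by ext; simp
  refine mem_of_eq h0 0 (Pi.single j t) ?_ ?_
  · rw [h]
    ext i
    simp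
  · rw [h]
    simp [mul_comm]

theorem add_mem_s1 (hK : IsRegularCone K) {u u' : Fin m → ℝ} {v v' : ℝ}
    (hv : v ∈ PrimalValues K A G u c d) (hv' : v' ∈ PrimalValues K A G u' c d) :
    v + v' ∈ PrimalValues K A G (u + u') c d := by
  obtain ⟨x, y, h, rfl⟩ := hv
  obtain ⟨x', y', h', rfl⟩ := hv'
  have hx : (fun i => (((x + x') i : ℤ) : ℝ)) =
      (fun i => (x i : ℝ)) + fun i => (x' i : ℝ) := by ext; simp
  refine ⟨x + x', y + y', ?_, ?_⟩
  · rw [hx, Matrix.mulVec_add, Matrix.mulVec_add]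
    convert hK.add_mem_s1 h h' using 1
    abel
  · simp only [Pi.add_apply, Int.cast_add, mul_add, Finset.sum_add_distrib]
    ring

theorem antitone (hK : IsRegularCone K) {u w : Fin m → ℝ} (huw : u - w ∈ K) :
    PrimalValues K A G u c d ⊆ PrimalValues K A G w c d := by
  rintro v ⟨x, y, h, rfl⟩
  refine ⟨x, y, ?_, rfl⟩
  convert hK.add_mem_s1 h huw using 1
  abel

theorem dotProduct_le {lam : Fin m → ℝ} (hlam : ∀ u ∈ K, 0 ≤ lam ⬝ᵥ u)
    (hA : lam ᵥ* A = c) (hG : lam ᵥ* G = d) {u : Fin m → ℝ} {v : ℝ}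
    (hv : v ∈ PrimalValues K A G u c d) : lam ⬝ᵥ u ≤ v := by
  obtain ⟨x, y, h, rfl⟩ := hv
  have h1 := hlam _ h
  rw [dotProduct_sub, dotProduct_add, Matrix.dotProduct_mulVec, Matrix.dotProduct_mulVec,
    hA, hG] at h1
  exact sub_nonneg.1 h1

end PrimalValues

section Subadditive

variable {f : (Fin m → ℝ) → ℝ}

theorem subadditive_sum_le (hf : ∀ u v, f (u + v) ≤ f u + f v) (h0 : f 0 = 0)
    {ι : Type*} (s : Finset ι) (g : ι → Fin m → ℝ) :
    f (∑ i ∈ s, g i) ≤ ∑ i ∈ s, f (g i) :=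
  Finset.le_sum_of_subadditive f h0.le hf s g

theorem subadditive_nsmul_le (hf : ∀ u v, f (u + v) ≤ f u + f v) (h0 : f 0 = 0)
    (n : ℕ) (w : Fin m → ℝ) : f (n • w) ≤ n * f w := by
  simpa using subadditive_sum_le hf h0 (Finset.range n) fun _ => w

theorem subadditive_zsmul_le (hf : ∀ u v, f (u + v) ≤ f u + f v) (h0 : f 0 = 0)
    {w : Fin m → ℝ} {r : ℝ} (hw : f w = r) (hw' : f (-w) = -r) (k : ℤ) :
    f ((k : ℝ) • w) ≤ k * r := by
  obtain ⟨n, rfl | rfl⟩ := k.eq_nat_or_neg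
  · have h := subadditive_nsmul_le hf h0 n w
    rw [hw] at h
    simpa [← Nat.cast_smul_eq_nsmul ℝ] using h
  · have h := subadditive_nsmul_le hf h0 n (-w)
    rw [hw'] at h
    simpa [← Nat.cast_smul_eq_nsmul ℝ] using h

theorem div_le_fbar (hf : ∀ u v, f (u + v) ≤ f u + f v) (h0 : f 0 = 0)
    {t : ℝ} (ht : 0 < t) (w : Fin m → ℝ) : ((f (t • w) / t : ℝ) : EReal) ≤ fbar f w := by
  have hlim : Tendsto (fun n : ℕ => t / ((n : ℝ) + 1)) atTop (nhdsWithin 0 (Set.Ioi 0)) := by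
    refine tendsto_nhdsWithin_iff.2 ⟨?_, Eventually.of_forall fun n => ?_⟩
    · simpa [div_eq_mul_inv] using
      (tendsto_one_div_add_atTop_nhds_zero_nat (𝕜 := ℝ)).const_mul t
    · exact div_pos ht n.cast_add_one_pos
  refine le_limsup_of_frequently_le (hlim.frequently (Eventually.of_forall fun n => ?_).frequently)
  have hn : (0 : ℝ) < n + 1 := n.cast_add_one_pos
  have h := subadditive_nsmul_le hf h0 (n + 1) ((t / ((n : ℝ) + 1)) • w)
  rw [← Nat.cast_smul_eq_nsmul ℝ, smul_smul, Nat.cast_add_one, mul_div_cancel₀ _ hn.ne'] at h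
  rw [EReal.coe_le_coe_iff, div_div_eq_mul_div]
  gcongr
  rwa [mul_comm]

theorem subadditive_smul_le (hf : ∀ u v, f (u + v) ≤ f u + f v) (h0 : f 0 = 0)
    {w : Fin m → ℝ} {r : ℝ} (hw : fbar f w = (r : EReal)) (hw' : fbar f (-w) = ((-r : ℝ) : EReal))
    (t : ℝ) : f (t • w) ≤ t * r := by
  rcases lt_trichotomy t 0 with ht | rfl | ht
  · have h := div_le_fbar hf h0 (neg_pos.2 ht) (-w)
    rw [hw', EReal.coe_le_coe_iff, div_le_iff₀ (neg_pos.2 ht), neg_smul_neg] at h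
    linarith
  · simp [h0]
  · have h := div_le_fbar hf h0 ht w
    rw [hw, EReal.coe_le_coe_iff, div_le_iff₀ ht] at h
    linarith

end Subadditive

/-- If `f (t w) = t r` for all `t ≥ 0`, then `f̄ w = r`. -/
theorem fbar_eq_of_forall_smul {f : (Fin m → ℝ) → ℝ} {w : Fin m → ℝ} {r : ℝ}
    (h : ∀ t : ℝ, 0 < t → f (t • w) = t * r) : fbar f w = (r : EReal) := by
  have hev : (fun δ : ℝ => ((f (δ • w) / δ : ℝ) : EReal)) =ᶠ[nhdsWithin 0 (Set.Ioi 0)]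
      fun _ => (r : EReal) := by
    filter_upwards [self_mem_nhdsWithin] with δ hδ
    rw [h δ hδ, mul_div_cancel_left₀ _ (ne_of_gt hδ)]
  rw [fbar, limsup_congr hev, limsup_const]

/-- Weak duality for the subadditive dual. -/
theorem DualFeasible.le_of_mem_primalValues {f : (Fin m → ℝ) → ℝ}
    (hf : DualFeasible K A G c d f) {b : Fin m → ℝ} {v : ℝ}
    (hv : v ∈ PrimalValues K A G b c d) : f b ≤ v := by
  obtain ⟨hsub, hmono, h0, hA, hG⟩ := hf
  obtain ⟨x, y, h, rfl⟩ := hv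
  have hcols {n : ℕ} (M : Matrix (Fin m) (Fin n) ℝ) (z : Fin n → ℝ) :
      f (M *ᵥ z) ≤ ∑ j, f (z j • fun i => M i j) := by
    have hM : M *ᵥ z = ∑ j, z j • fun i => M i j := by
      ext i
      simp [Matrix.mulVec, dotProduct, mul_comm]
    rw [hM]
    exact subadditive_sum_le hsub h0 _ _
  calc f b ≤ f (A *ᵥ (fun i => (x i : ℝ)) + G *ᵥ y) := hmono _ _ h
    _ ≤ f (A *ᵥ fun i => (x i : ℝ)) + f (G *ᵥ y) := hsub _ _
    _ ≤ _ := by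
      refine add_le_add ((hcols _ _).trans (Finset.sum_le_sum fun j _ => ?_))
        ((hcols _ _).trans (Finset.sum_le_sum fun j _ => ?_))
      · rw [mul_comm]
        exact subadditive_zsmul_le hsub h0 (hA j).1 (hA j).2 (x j)
      · rw [mul_comm]
        exact subadditive_smul_le hsub h0 (hG j).1 (hG j).2 (y j)

/-- The value function of the conic MIP, capped by the affine function `u ↦ lam ⬝ᵥ u + M`
so that it is finite everywhere. -/
noncomputable def cappedValue (K : Set (Fin m → ℝ)) (A : Matrix (Fin m) (Fin n1) ℝ)
    (G : Matrix (Fin m) (Fin n2) ℝ) (c : Fin n1 → ℝ) (d : Fin n2 → ℝ)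
    (lam : Fin m → ℝ) (M : ℝ) (u : Fin m → ℝ) : ℝ :=
  sInf (insert (lam ⬝ᵥ u + M) (PrimalValues K A G u c d))

section CappedValue

variable {lam : Fin m → ℝ} {M : ℝ}

theorem dotProduct_mem_lowerBounds (hlam : ∀ u ∈ K, 0 ≤ lam ⬝ᵥ u)
    (hA : lam ᵥ* A = c) (hG : lam ᵥ* G = d) (hM : 0 ≤ M) (u : Fin m → ℝ) :
    lam ⬝ᵥ u ∈ lowerBounds (insert (lam ⬝ᵥ u + M) (PrimalValues K A G u c d)) := by
  rintro v (rfl | hv)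
  · linarith
  · exact PrimalValues.dotProduct_le hlam hA hG hv

theorem cappedValue_isGLB (hlam : ∀ u ∈ K, 0 ≤ lam ⬝ᵥ u)
    (hA : lam ᵥ* A = c) (hG : lam ᵥ* G = d) (hM : 0 ≤ M) (u : Fin m → ℝ) :
    IsGLB (insert (lam ⬝ᵥ u + M) (PrimalValues K A G u c d))
      (cappedValue K A G c d lam M u) :=
  isGLB_csInf (Set.insert_nonempty _ _) ⟨_, dotProduct_mem_lowerBounds hlam hA hG hM u⟩

theorem cappedValue_eq_of_mem (hlam : ∀ u ∈ K, 0 ≤ lam ⬝ᵥ u)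
    (hA : lam ᵥ* A = c) (hG : lam ᵥ* G = d) (hM : 0 ≤ M) {u : Fin m → ℝ}
    (hu : lam ⬝ᵥ u ∈ PrimalValues K A G u c d) :
    cappedValue K A G c d lam M u = lam ⬝ᵥ u :=
  (cappedValue_isGLB hlam hA hG hM u).unique
    (IsLeast.isGLB ⟨Or.inr hu, dotProduct_mem_lowerBounds hlam hA hG hM u⟩)

theorem cappedValue_dualFeasible (hK : IsRegularCone K) (hlam : ∀ u ∈ K, 0 ≤ lam ⬝ᵥ u)
    (hA : lam ᵥ* A = c) (hG : lam ᵥ* G = d) (hM : 0 ≤ M) :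
    DualFeasible K A G c d (cappedValue K A G c d lam M) := by
  have hglb := cappedValue_isGLB hlam hA hG hM
  have hlb := dotProduct_mem_lowerBounds hlam hA hG hM
  have heq {u : Fin m → ℝ} {v : ℝ} (hu : lam ⬝ᵥ u = v)
      (hv : v ∈ PrimalValues K A G u c d) : cappedValue K A G c d lam M u = v := by
    subst hu
    exact cappedValue_eq_of_mem hlam hA hG hM hv
  have hAk (j : Fin n1) (k : ℤ) :
      cappedValue K A G c d lam M (fun i => k * A i j) = k * c j := by
    refine heq ?_ (PrimalValues.intCol_mem hK.zero_mem_s1 j k)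
    rw [← hA]
    simp [Matrix.vecMul, dotProduct, Finset.mul_sum, mul_left_comm]
  have hGt (j : Fin n2) (t : ℝ) :
      cappedValue K A G c d lam M (fun i => t * G i j) = t * d j := by
    refine heq ?_ (PrimalValues.realCol_mem hK.zero_mem_s1 j t)
    rw [← hG]
    simp [Matrix.vecMul, dotProduct, Finset.mul_sum, mul_left_comm]
  refine ⟨fun u w => ?_, fun u w huw => (hglb u).2 ?_, ?_, fun j => ⟨?_, ?_⟩,
    fun j => ⟨fbar_eq_of_forall_smul fun t _ => hGt j t, fbar_eq_of_forall_smul fun t _ => ?_⟩⟩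
  · have key : ∀ v ∈ insert (lam ⬝ᵥ u + M) (PrimalValues K A G u c d),
        ∀ v' ∈ insert (lam ⬝ᵥ w + M) (PrimalValues K A G w c d),
        cappedValue K A G c d lam M (u + w) ≤ v + v' := by
      intro v hv v' hv'
      have hcap := (hglb (u + w)).1 (Set.mem_insert _ _)
      rw [dotProduct_add] at hcap
      have hvl := hlb u hv
      have hvl' := hlb w hv'
      rcases hv with rfl | hv
      · linarith
      rcases hv' with rfl | hv'
      · linarith
      exact (hglb (u + w)).1 (Or.inr (PrimalValues.add_mem_s1 hK hv hv'))
    rw [← sub_le_iff_le_add']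
    refine (hglb w).2 fun v' hv' => ?_
    rw [sub_le_comm]
    exact (hglb u).2 fun v hv => sub_le_iff_le_add.2 (key v hv v' hv')
  · rintro v (rfl | hv)
    · have h := hlam _ huw
      rw [dotProduct_sub] at h
      exact ((hglb w).1 (Set.mem_insert _ _)).trans (by linarith)
    · exact (hglb w).1 (Or.inr (PrimalValues.antitone hK huw hv))
  · exact heq (dotProduct_zero _) (PrimalValues.zero_mem_s1 hK.zero_mem_s1)
  · simpa using hAk j 1
  · simpa using hAk j (-1)
  · rw [mul_neg, ← neg_mul, ← hGt]
    congr 1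
    ext i
    simp

end CappedValue

end

theorem subadditive_dual_strong_of_continuous_dual_feasible
    {m n1 n2 : ℕ} (K : Set (Fin m → ℝ))
    (A : Matrix (Fin m) (Fin n1) ℝ) (G : Matrix (Fin m) (Fin n2) ℝ)
    (b : Fin m → ℝ) (c : Fin n1 → ℝ) (d : Fin n2 → ℝ)
    (hK : IsRegularCone K)
    (hprimal : ∃ (x : Fin n1 → ℤ) (y : Fin n2 → ℝ),
      A.mulVec (fun i => (x i : ℝ)) + G.mulVec y - b ∈ K)
    (hdualLP : ∃ lam : Fin m → ℝ, (∀ u ∈ K, 0 ≤ ∑ i, lam i * u i) ∧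
      (∀ j, (∑ i, lam i * A i j) = c j) ∧ (∀ j, (∑ i, lam i * G i j) = d j)) :
    ∃ zstar : ℝ, IsGLB (PrimalValues K A G b c d) zstar ∧
      (∀ f, DualFeasible K A G c d f → f b ≤ zstar) ∧
      (∃ f, DualFeasible K A G c d f ∧ f b = zstar) := by
  obtain ⟨lam, hlam, hA, hG⟩ := hdualLP
  replace hA : Matrix.vecMul lam A = c := funext hA
  replace hG : Matrix.vecMul lam G = d := funext hG
  obtain ⟨x, y, hxy⟩ := hprimal
  have hne : (PrimalValues K A G b c d).Nonempty := ⟨_, x, y, hxy, rfl⟩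
  have hlow : dotProduct lam b ∈ lowerBounds (PrimalValues K A G b c d) :=
    fun v hv => PrimalValues.dotProduct_le hlam hA hG hv
  obtain ⟨z, hz⟩ : ∃ z, IsGLB (PrimalValues K A G b c d) z :=
    ⟨_, isGLB_csInf hne ⟨_, hlow⟩⟩
  have hM : 0 ≤ z - dotProduct lam b := sub_nonneg.2 (hz.2 hlow)
  refine ⟨z, hz, fun f hf => hz.2 fun v hv => hf.le_of_mem_primalValues hv,
    cappedValue K A G c d lam (z - dotProduct lam b),
    cappedValue_dualFeasible hK hlam hA hG hM, ?_⟩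
  have hcap := hz.insert (dotProduct lam b + (z - dotProduct lam b))
  rw [add_sub_cancel, min_self] at hcap
  refine (cappedValue_isGLB hlam hA hG hM b).unique ?_
  rwa [add_sub_cancel]
end

section
/- Consider the binary conic MIP z* = inf{c·x + d·y : Ax + Gy − b ∈ K, x ∈ {0,1}^{n₁}, y ∈ ℝ^{n₂}}. Suppose z* > −∞ and there exists (x̂, ŷ) ∈ {0,1}^{n₁} × ℝ^{n₂} with Ax̂ + Gŷ − b ∈ int(K). Then the subadditive dual of the binary conic MIP is a strong dual: every feasible dual function F satisfies F(b, 0, −e) ≤ z*, and there exists a feasible dual function F* with F*(b, 0, −e) = z*. Here, writing e ∈ ℝ^{n₁} for the all-ones vector and e^j ∈ ℝ^{n₁} for the j-th unit vector, a function F : ℝ^m × ℝ^{n₁} × ℝ^{n₁} → ℝ is feasible for the subadditive dual of the binary conic MIP if F ∈ 𝓕_{K × ℝ₊^{n₁} × ℝ₊^{n₁}}, F(0,0,0) = 0, F(A^j, e^j, −e^j) = −F(−A^j, −e^j, e^j) = c_j for j = 1,…,n₁, and F̄(G^j, 0, 0) = −F̄(−G^j, 0, 0) = d_j for j = 1,…,n₂.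 -/
/-- `F̄ w = limsup_{δ → 0⁺} F (δ w) / δ` (in the extended reals), for functions on
`ℝ^m × ℝ^{n₁} × ℝ^{n₁}`. -/
noncomputable def fbarP {m n1 : ℕ}
    (F : ((Fin m → ℝ) × (Fin n1 → ℝ) × (Fin n1 → ℝ)) → ℝ)
    (w : (Fin m → ℝ) × (Fin n1 → ℝ) × (Fin n1 → ℝ)) : EReal :=
  Filter.limsup (fun δ : ℝ => ((F (δ • w) / δ : ℝ) : EReal)) (nhdsWithin 0 (Set.Ioi 0))

/-- The product cone `K × ℝ₊^{n₁} × ℝ₊^{n₁}`. -/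
def ConeProd {m n1 : ℕ} (K : Set (Fin m → ℝ)) :
    Set ((Fin m → ℝ) × (Fin n1 → ℝ) × (Fin n1 → ℝ)) :=
  {p | p.1 ∈ K ∧ (∀ i, 0 ≤ p.2.1 i) ∧ (∀ i, 0 ≤ p.2.2 i)}

/-- Feasibility of `F : ℝ^m × ℝ^{n₁} × ℝ^{n₁} → ℝ` for the subadditive dual of the
binary conic MIP: `F ∈ 𝓕_{K × ℝ₊^{n₁} × ℝ₊^{n₁}}`, `F(0,0,0) = 0`,
`F(A^j, e^j, -e^j) = -F(-A^j, -e^j, e^j) = c_j` and `F̄(G^j,0,0) = -F̄(-G^j,0,0) = d_j`. -/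
def BinaryDualFeasible {m n1 n2 : ℕ} (K : Set (Fin m → ℝ))
    (A : Matrix (Fin m) (Fin n1) ℝ) (G : Matrix (Fin m) (Fin n2) ℝ)
    (c : Fin n1 → ℝ) (d : Fin n2 → ℝ)
    (F : ((Fin m → ℝ) × (Fin n1 → ℝ) × (Fin n1 → ℝ)) → ℝ) : Prop :=
  (∀ u v, F (u + v) ≤ F u + F v) ∧
  (∀ u v, u - v ∈ ConeProd K → F v ≤ F u) ∧
  F 0 = 0 ∧
  (∀ j, F ((fun i => A i j), Pi.single j 1, -Pi.single j 1) = c j ∧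
        F ((fun i => -A i j), -Pi.single j 1, Pi.single j 1) = -c j) ∧
  (∀ j, fbarP F ((fun i => G i j), 0, 0) = ((d j : ℝ) : EReal) ∧
        fbarP F ((fun i => -G i j), 0, 0) = ((-d j : ℝ) : EReal))

/-- The set of objective values of feasible solutions of the binary conic MIP
`inf {c·x + d·y : A x + G y - b ∈ K, x ∈ {0,1}^{n₁}, y ∈ ℝ^{n₂}}`. -/
def BinaryPrimalValues {m n1 n2 : ℕ} (K : Set (Fin m → ℝ))
    (A : Matrix (Fin m) (Fin n1) ℝ) (G : Matrix (Fin m) (Fin n2) ℝ)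
    (b : Fin m → ℝ) (c : Fin n1 → ℝ) (d : Fin n2 → ℝ) : Set ℝ :=
  {v | ∃ (x : Fin n1 → ℝ) (y : Fin n2 → ℝ), (∀ i, x i = 0 ∨ x i = 1) ∧
    A.mulVec x + G.mulVec y - b ∈ K ∧
    v = (∑ i, c i * x i) + ∑ j, d j * y j}

open Filter Topology

section WeakDuality

lemma subadditive_natCast_smul_le {E : Type*} [AddCommGroup E] [Module ℝ E] {F : E → ℝ}
    (hsub : ∀ u v, F (u + v) ≤ F u + F v) (h0 : F 0 = 0) (w : E) (n : ℕ) :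
    F ((n : ℝ) • w) ≤ n * F w := by
  induction n with
  | zero => simp [h0]
  | succ k ih =>
    have := hsub ((k : ℝ) • w) w
    push_cast
    rw [add_smul, one_smul]
    linarith

/-- A subadditive function vanishing at the origin is bounded along each ray by its upper
directional derivative at the origin. -/
lemma apply_smul_le_of_fbarP_eq {m n1 : ℕ}
    {F : ((Fin m → ℝ) × (Fin n1 → ℝ) × (Fin n1 → ℝ)) → ℝ}
    (hsub : ∀ u v, F (u + v) ≤ F u + F v) (h0 : F 0 = 0)
    {w : (Fin m → ℝ) × (Fin n1 → ℝ) × (Fin n1 → ℝ)} {a : ℝ}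
    (ha : fbarP F w = (a : EReal)) {t : ℝ} (ht : 0 ≤ t) : F (t • w) ≤ t * a := by
  rcases ht.eq_or_lt with rfl | ht
  · simp [h0]
  have htend : Tendsto (fun n : ℕ => t * (1 / ((n : ℝ) + 1))) atTop (𝓝[>] 0) := by
    refine tendsto_nhdsWithin_iff.2 ⟨?_, Eventually.of_forall fun n => ?_⟩
    · simpa using tendsto_one_div_add_atTop_nhds_zero_nat.const_mul t
    · exact mul_pos ht (by positivity)
  have hle : ∀ n : ℕ, ((F (t • w) / t : ℝ) : EReal) ≤
      ((F ((t * (1 / ((n : ℝ) + 1))) • w) / (t * (1 / ((n : ℝ) + 1))) : ℝ) : EReal) := by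
    intro n
    have hn : (0 : ℝ) < n + 1 := by positivity
    have h := subadditive_natCast_smul_le hsub h0 ((t * (1 / ((n : ℝ) + 1))) • w) (n + 1)
    rw [smul_smul] at h
    push_cast at h
    have he : ((n : ℝ) + 1) * (t * (1 / ((n : ℝ) + 1))) = t := by field_simp
    rw [he] at h
    rw [EReal.coe_le_coe_iff, div_le_div_iff₀ ht (by positivity)]
    calc F (t • w) * (t * (1 / ((n : ℝ) + 1)))
        ≤ (((n : ℝ) + 1) * F ((t * (1 / ((n : ℝ) + 1))) • w)) * (t * (1 / ((n : ℝ) + 1))) := by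
          gcongr
      _ = F ((t * (1 / ((n : ℝ) + 1))) • w) * t := by field_simp
  have hfreq : ∃ᶠ δ in 𝓝[>] (0 : ℝ), ((F (t • w) / t : ℝ) : EReal) ≤
      ((F (δ • w) / δ : ℝ) : EReal) :=
    htend.frequently (Eventually.of_forall hle).frequently
  have := le_limsup_of_frequently_le hfreq
  rw [← fbarP, ha, EReal.coe_le_coe_iff, div_le_iff₀ ht] at this
  linarith

lemma eq_sum_smul_columns {m n1 n2 : ℕ} (A : Matrix (Fin m) (Fin n1) ℝ)
    (G : Matrix (Fin m) (Fin n2) ℝ) (x : Fin n1 → ℝ) (y : Fin n2 → ℝ) :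
    ((A.mulVec x + G.mulVec y, x, -x) : (Fin m → ℝ) × (Fin n1 → ℝ) × (Fin n1 → ℝ)) =
      (∑ j, x j • ((fun i => A i j), Pi.single j 1, -Pi.single j 1)) +
        ∑ j, y j • ((fun i => G i j), 0, 0) := by
  refine Prod.ext ?_ (Prod.ext ?_ ?_)
  · funext i
    simp [Prod.fst_sum, Matrix.mulVec, dotProduct, mul_comm]
  · funext i
    simp [Prod.fst_sum, Prod.snd_sum, Pi.single_apply]
  · funext i
    simp [Prod.snd_sum, Pi.single_apply]

lemma BinaryDualFeasible.le_of_mem_primalValues {m n1 n2 : ℕ} {K : Set (Fin m → ℝ)}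
    {A : Matrix (Fin m) (Fin n1) ℝ} {G : Matrix (Fin m) (Fin n2) ℝ} {b : Fin m → ℝ}
    {c : Fin n1 → ℝ} {d : Fin n2 → ℝ} {F : ((Fin m → ℝ) × (Fin n1 → ℝ) × (Fin n1 → ℝ)) → ℝ}
    (hF : BinaryDualFeasible K A G c d F) {v : ℝ} (hv : v ∈ BinaryPrimalValues K A G b c d) :
    F (b, 0, fun _ => (-1 : ℝ)) ≤ v := by
  obtain ⟨hsub, hmono, h0, hA, hG⟩ := hF
  obtain ⟨x, y, hx, hK, rfl⟩ := hv
  have h1 : F (b, 0, fun _ => (-1 : ℝ)) ≤ F (A.mulVec x + G.mulVec y, x, -x) := by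
    refine hmono _ _ ⟨by simpa using hK, fun i => ?_, fun i => ?_⟩ <;>
      rcases hx i with h | h <;> simp [h]
  rw [eq_sum_smul_columns] at h1
  refine h1.trans ((hsub _ _).trans (add_le_add ?_ ?_))
  · refine (Finset.le_sum_of_subadditive F h0.le hsub _ _).trans (Finset.sum_le_sum fun j _ => ?_)
    rcases hx j with h | h <;> simp [h, h0, (hA j).1]
  · refine (Finset.le_sum_of_subadditive F h0.le hsub _ _).trans (Finset.sum_le_sum fun j _ => ?_)
    rcases le_total 0 (y j) with h | h
    · rw [mul_comm]
      exact apply_smul_le_of_fbarP_eq hsub h0 (hG j).1 h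
    · have := apply_smul_le_of_fbarP_eq hsub h0 (hG j).2 (neg_nonneg.2 h)
      have he : (-y j) • (((fun i => -G i j), 0, 0) :
          (Fin m → ℝ) × (Fin n1 → ℝ) × (Fin n1 → ℝ)) = y j • ((fun i => G i j), 0, 0) := by
        refine Prod.ext ?_ (Prod.ext ?_ ?_)
        · funext i; simp
        · simp
        · simp
      rw [he] at this
      linarith

end WeakDuality

section InfConvolution

variable {Z E : Type*} [AddCommGroup Z] [AddCommGroup E]

/-- The infimal convolution of `L` with the additive cost `κ` carried by the image of `φ`. -/
noncomputable def infConv (φ : Z →+ E) (κ : Z →+ ℝ) (L : E → ℝ) (p : E) : ℝ :=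
  ⨅ z, (κ z + L (p - φ z))

variable {φ : Z →+ E} {κ : Z →+ ℝ} {L : E → ℝ}

lemma infConv_le (hbdd : ∀ p, BddBelow (Set.range fun z => κ z + L (p - φ z))) (p : E) (z : Z) :
    infConv φ κ L p ≤ κ z + L (p - φ z) :=
  ciInf_le (hbdd p) z

lemma infConv_add_le (hbdd : ∀ p, BddBelow (Set.range fun z => κ z + L (p - φ z)))
    (hL : ∀ u v, L (u + v) ≤ L u + L v) (p q : E) :
    infConv φ κ L (p + q) ≤ infConv φ κ L p + infConv φ κ L q := by
  refine le_ciInf_add_ciInf fun z z' => ?_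
  have h1 := infConv_le hbdd (p + q) (z + z')
  have h2 := hL (p - φ z) (q - φ z')
  rw [map_add, map_add, add_sub_add_comm] at h1
  linarith

lemma infConv_mono (hbdd : ∀ p, BddBelow (Set.range fun z => κ z + L (p - φ z)))
    {C : Set E} (hL : ∀ u v, u - v ∈ C → L v ≤ L u) (p q : E) (hpq : p - q ∈ C) :
    infConv φ κ L q ≤ infConv φ κ L p :=
  ciInf_mono (hbdd q) fun z => by
    have := hL (p - φ z) (q - φ z) (by simpa using hpq)
    linarith

lemma infConv_map (hbdd : ∀ p, BddBelow (Set.range fun z => κ z + L (p - φ z)))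
    (hL : ∀ u v, L (u + v) ≤ L u + L v) (hL0 : L 0 = 0) (z : Z) :
    infConv φ κ L (φ z) = κ z := by
  have hle : ∀ z, infConv φ κ L (φ z) ≤ κ z := fun z => by
    simpa [hL0] using infConv_le hbdd (φ z) z
  have h1 := infConv_add_le hbdd hL (φ z) (φ (-z))
  have h2 := infConv_add_le hbdd hL 0 0
  have h3 := hle (-z)
  rw [← map_add, add_neg_cancel, map_zero] at h1
  rw [add_zero] at h2
  rw [map_neg κ] at h3
  linarith [hle z]

end InfConvolution

lemma Convex.add_mem_of_smul_mem {E : Type*} [AddCommGroup E] [Module ℝ E] {K : Set E}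
    (hconv : Convex ℝ K) (hcone : ∀ x ∈ K, ∀ t : ℝ, 0 ≤ t → t • x ∈ K) {u v : E} (hu : u ∈ K)
    (hv : v ∈ K) : u + v ∈ K := by
  have := hcone _ (hconv hu hv (by norm_num : (0 : ℝ) ≤ 1 / 2) (by norm_num : (0 : ℝ) ≤ 1 / 2)
    (by norm_num)) 2 (by norm_num)
  simpa [smul_add, smul_smul] using this

/-- Conic duality, feasibility part: if `inf {d·y : G y + q ∈ K}` is bounded below and strictly
feasible, its conic dual is feasible. -/
lemma exists_conic_multiplier {m n : ℕ} {K : Set (Fin m → ℝ)} (hconv : Convex ℝ K)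
    (hcone : ∀ x ∈ K, ∀ t : ℝ, 0 ≤ t → t • x ∈ K) (G : Matrix (Fin m) (Fin n) ℝ)
    (d : Fin n → ℝ) (q : Fin m → ℝ) (β : ℝ) (hβ : ∀ y, G.mulVec y + q ∈ K → β ≤ d ⬝ᵥ y)
    (y₀ : Fin n → ℝ) (hy₀ : G.mulVec y₀ + q ∈ interior K) :
    ∃ μ : (Fin m → ℝ) →ₗ[ℝ] ℝ, (∀ u ∈ K, 0 ≤ μ u) ∧ ∀ y, μ (G.mulVec y) = d ⬝ᵥ y := by
  have hadd : ∀ u ∈ K, ∀ v ∈ K, u + v ∈ K := fun u hu v hv =>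
    hconv.add_mem_of_smul_mem hcone hu hv
  let P : Set ((Fin m → ℝ) × ℝ) :=
    {p | ∃ (y : Fin n → ℝ) (τ : ℝ), 0 ≤ τ ∧ p = (G.mulVec y + τ • q, d ⬝ᵥ y - τ * β)}
  have hPsmul : ∀ p ∈ P, ∀ t : ℝ, 0 ≤ t → t • p ∈ P := by
    rintro _ ⟨y, τ, hτ, rfl⟩ t ht
    refine ⟨t • y, t * τ, by positivity, ?_⟩
    simp [Matrix.mulVec_smul, smul_smul, mul_sub, mul_assoc]
  have hPadd : ∀ p ∈ P, ∀ p' ∈ P, p + p' ∈ P := by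
    rintro _ ⟨y, τ, hτ, rfl⟩ _ ⟨y', τ', hτ', rfl⟩
    refine ⟨y + y', τ + τ', by positivity, ?_⟩
    refine Prod.ext ?_ ?_
    · simp only [Prod.fst_add, Matrix.mulVec_add, add_smul]; abel
    · simp only [Prod.snd_add, dotProduct_add]; ring
  have hPconv : Convex ℝ P := fun p hp p' hp' s t hs ht _ =>
    hPadd _ (hPsmul p hp s hs) _ (hPsmul p' hp' t ht)
  have hdisj : Disjoint (interior K ×ˢ Set.Iio (0 : ℝ)) P := by
    rw [Set.disjoint_left]
    rintro _ ⟨hu, ht⟩ ⟨y, τ, hτ, rfl⟩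
    replace hu := interior_subset hu
    simp only [Set.mem_Iio] at ht hu
    rcases hτ.eq_or_lt with rfl | hτ
    · simp only [zero_smul, add_zero, zero_mul, sub_zero] at hu ht
      -- a recession direction of negative cost makes the problem unbounded
      set r : ℝ := (|d ⬝ᵥ y₀ - β| + 1) / -(d ⬝ᵥ y)
      have hr : 0 ≤ r := div_nonneg (by positivity) (by linarith)
      have h := hβ (y₀ + r • y) (by
        rw [Matrix.mulVec_add, Matrix.mulVec_smul, add_right_comm]
        exact hadd _ (interior_subset hy₀) _ (hcone _ hu r hr))
      rw [dotProduct_add, dotProduct_smul, smul_eq_mul] at h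
      have hr' : r * (d ⬝ᵥ y) = -(|d ⬝ᵥ y₀ - β| + 1) := by
        have hne : d ⬝ᵥ y ≠ 0 := ht.ne
        simp only [r]
        field_simp
      linarith [le_abs_self (d ⬝ᵥ y₀ - β)]
    · have h := hβ (τ⁻¹ • y) (by
        have := hcone _ hu τ⁻¹ (by positivity)
        rwa [smul_add, smul_smul, inv_mul_cancel₀ hτ.ne', one_smul, ← Matrix.mulVec_smul] at this)
      rw [dotProduct_smul, smul_eq_mul, inv_mul_eq_div, le_div_iff₀ hτ] at h
      linarith
  obtain ⟨f, s, hfs, hsf⟩ := geometric_hahn_banach_open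
    (hconv.interior.prod (convex_Iio (0 : ℝ))) (isOpen_interior.prod isOpen_Iio) hPconv hdisj
  have hs : s ≤ 0 := by
    simpa using hsf 0 ⟨0, 0, le_rfl, by simp; rfl⟩
  have hfP : ∀ p ∈ P, 0 ≤ f p := by
    intro p hp
    by_contra! hneg
    have h := hsf _ (hPsmul p hp ((s - 1) / f p) (div_nonneg_of_nonpos (by linarith) hneg.le))
    rw [map_smul, smul_eq_mul, div_mul_cancel₀ _ hneg.ne] at h
    linarith
  have hsplit : ∀ u t, f (u, t) = f (u, 0) + t * f (0, 1) := fun u t => by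
    rw [← smul_eq_mul, ← map_smul, ← map_add]
    simp
  set a : ℝ := f (0, 1) with ha
  have hneg : ∀ u ∈ interior K, ∀ t < 0, f (u, 0) + t * a < 0 := fun u hu t ht => by
    rw [← hsplit]
    exact (hfs (u, t) ⟨hu, ht⟩).trans_le hs
  have hapos : 0 < a := by
    have h1 := hfP _ ⟨y₀, 1, zero_le_one, rfl⟩
    rw [hsplit, one_smul] at h1
    by_contra! ha'
    have h2 := hneg _ hy₀ (min (-1) (d ⬝ᵥ y₀ - 1 * β)) (by simp)
    nlinarith [min_le_right (-1) (d ⬝ᵥ y₀ - 1 * β)]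
  have hint : ∀ u ∈ interior K, f (u, 0) ≤ 0 := fun u hu => by
    by_contra! h
    have := hneg u hu (-(f (u, 0) / a)) (neg_neg_of_pos (by positivity))
    rw [neg_mul, div_mul_cancel₀ _ hapos.ne'] at this
    linarith
  have hKle : ∀ u ∈ K, f (u, 0) ≤ 0 := by
    intro u hu
    have hcl : u ∈ closure (interior K) := by
      rw [hconv.closure_interior_eq_closure_of_nonempty_interior ⟨_, hy₀⟩]
      exact subset_closure hu
    exact closure_minimal (t := {u | f (u, 0) ≤ 0}) hint
      (isClosed_le (by fun_prop) continuous_const) hcl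
  have hG : ∀ y, f (G.mulVec y, 0) + (d ⬝ᵥ y) * a = 0 := by
    have hge : ∀ y, 0 ≤ f (G.mulVec y, 0) + (d ⬝ᵥ y) * a := fun y => by
      rw [← hsplit]
      exact hfP _ ⟨y, 0, le_rfl, by simp⟩
    intro y
    have h1 := hge (-y)
    have h2 : f (G.mulVec (-y), 0) = - f (G.mulVec y, 0) := by
      rw [← map_neg]
      simp [Matrix.mulVec_neg]
    rw [h2, dotProduct_neg] at h1
    linarith [hge y]
  refine ⟨-a⁻¹ • (f : (Fin m → ℝ) × ℝ →ₗ[ℝ] ℝ) ∘ₗ LinearMap.inl ℝ _ _, fun u hu => ?_,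
    fun y => ?_⟩
  · have := mul_nonneg (inv_nonneg.2 hapos.le) (neg_nonneg.2 (hKle u hu))
    simp
    linarith
  · have : f (G.mulVec y, 0) = -((d ⬝ᵥ y) * a) := by linarith [hG y]
    simp [this]
    field_simp

section Penalty

variable {m n1 n2 : ℕ}

/-- A monotone subadditive penalty vanishing on `-(K × ℝ₊^{n₁} × ℝ₊^{n₁})`. -/
noncomputable def conePenalty (K : Set (Fin m → ℝ)) (μ : (Fin m → ℝ) →ₗ[ℝ] ℝ) (M N : ℝ)
    (p : (Fin m → ℝ) × (Fin n1 → ℝ) × (Fin n1 → ℝ)) : ℝ :=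
  open Classical in
  (if -p ∈ ConeProd K then 0 else M) +
    max 0 (μ p.1 + ∑ i, N * (max (p.2.1 i) 0 + max (p.2.2 i) 0))

variable {K : Set (Fin m → ℝ)} {μ : (Fin m → ℝ) →ₗ[ℝ] ℝ} {M N : ℝ}

lemma ConeProd.add_mem (hadd : ∀ u ∈ K, ∀ v ∈ K, u + v ∈ K)
    {p q : (Fin m → ℝ) × (Fin n1 → ℝ) × (Fin n1 → ℝ)} (hp : p ∈ ConeProd K)
    (hq : q ∈ ConeProd K) : p + q ∈ ConeProd K :=
  ⟨hadd _ hp.1 _ hq.1, fun i => add_nonneg (hp.2.1 i) (hq.2.1 i),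
    fun i => add_nonneg (hp.2.2 i) (hq.2.2 i)⟩

lemma conePenalty_add_le (hadd : ∀ u ∈ K, ∀ v ∈ K, u + v ∈ K) (hM : 0 ≤ M) (hN : 0 ≤ N)
    (p q : (Fin m → ℝ) × (Fin n1 → ℝ) × (Fin n1 → ℝ)) :
    conePenalty K μ M N (p + q) ≤ conePenalty K μ M N p + conePenalty K μ M N q := by
  unfold conePenalty
  rw [add_add_add_comm]
  refine add_le_add ?_ ?_
  · by_cases hp : -p ∈ ConeProd K <;> by_cases hq : -q ∈ ConeProd K
    · have : -(p + q) ∈ ConeProd K := by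
        rw [neg_add]
        exact ConeProd.add_mem hadd hp hq
      rw [if_pos hp, if_pos hq, if_pos this, add_zero]
    all_goals
      simp only [hp, hq, if_true, if_false]
      split_ifs <;> linarith
  · refine max_le (by positivity) ?_
    have h : ∑ i, N * (max ((p + q).2.1 i) 0 + max ((p + q).2.2 i) 0) ≤
        ∑ i, N * (max (p.2.1 i) 0 + max (p.2.2 i) 0) +
          ∑ i, N * (max (q.2.1 i) 0 + max (q.2.2 i) 0) := by
      rw [← Finset.sum_add_distrib]
      refine Finset.sum_le_sum fun i _ => ?_
      rw [← mul_add]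
      refine mul_le_mul_of_nonneg_left ?_ hN
      have h' : ∀ s t : ℝ, max (s + t) 0 ≤ max s 0 + max t 0 := fun s t =>
        max_le (add_le_add (le_max_left _ _) (le_max_left _ _)) (by positivity)
      have h1 := h' (p.2.1 i) (q.2.1 i)
      have h2 := h' (p.2.2 i) (q.2.2 i)
      simp only [Prod.snd_add, Prod.fst_add, Pi.add_apply]
      linarith
    rw [Prod.fst_add, map_add]
    have h1 := le_max_right 0 (μ p.1 + ∑ i, N * (max (p.2.1 i) 0 + max (p.2.2 i) 0))
    have h2 := le_max_right 0 (μ q.1 + ∑ i, N * (max (q.2.1 i) 0 + max (q.2.2 i) 0))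
    linarith

lemma conePenalty_mono (hadd : ∀ u ∈ K, ∀ v ∈ K, u + v ∈ K) (hμ : ∀ u ∈ K, 0 ≤ μ u)
    (hM : 0 ≤ M) (hN : 0 ≤ N) (p q : (Fin m → ℝ) × (Fin n1 → ℝ) × (Fin n1 → ℝ))
    (hpq : p - q ∈ ConeProd K) : conePenalty K μ M N q ≤ conePenalty K μ M N p := by
  refine add_le_add ?_ (max_le_max le_rfl (add_le_add ?_ (Finset.sum_le_sum fun i _ =>
    mul_le_mul_of_nonneg_left (add_le_add (max_le_max ?_ le_rfl) (max_le_max ?_ le_rfl)) hN)))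
  · by_cases hp : -p ∈ ConeProd K
    · have : -q ∈ ConeProd K := by
        have := ConeProd.add_mem hadd hpq hp
        rwa [show p - q + -p = -q by abel] at this
      simp [hp, this]
    · simp only [hp, if_false]
      split_ifs <;> linarith
  · have := hμ _ hpq.1
    rw [Prod.fst_sub, map_sub] at this
    linarith
  · simpa using hpq.2.1 i
  · simpa using hpq.2.2 i

lemma conePenalty_zero (hK0 : (0 : Fin m → ℝ) ∈ K) :
    conePenalty K μ M N (0 : (Fin m → ℝ) × (Fin n1 → ℝ) × (Fin n1 → ℝ)) = 0 := by
  have : (0 : (Fin m → ℝ) × (Fin n1 → ℝ) × (Fin n1 → ℝ)) ∈ ConeProd K :=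
    ⟨hK0, fun _ => le_rfl, fun _ => le_rfl⟩
  simp [conePenalty, this]

lemma le_conePenalty (hM : 0 ≤ M) (p : (Fin m → ℝ) × (Fin n1 → ℝ) × (Fin n1 → ℝ)) :
    μ p.1 + ∑ i, N * (max (p.2.1 i) 0 + max (p.2.2 i) 0) ≤ conePenalty K μ M N p := by
  have h := le_max_right 0 (μ p.1 + ∑ i, N * (max (p.2.1 i) 0 + max (p.2.2 i) 0))
  unfold conePenalty
  split_ifs <;> linarith

lemma le_conePenalty_of_notMem {p : (Fin m → ℝ) × (Fin n1 → ℝ) × (Fin n1 → ℝ)}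
    (hp : -p ∉ ConeProd K) :
    M + (μ p.1 + ∑ i, N * (max (p.2.1 i) 0 + max (p.2.2 i) 0)) ≤ conePenalty K μ M N p := by
  simp [conePenalty, hp]

lemma conePenalty_nonneg (hM : 0 ≤ M) (p : (Fin m → ℝ) × (Fin n1 → ℝ) × (Fin n1 → ℝ)) :
    0 ≤ conePenalty K μ M N p := by
  have h := le_max_left 0 (μ p.1 + ∑ i, N * (max (p.2.1 i) 0 + max (p.2.2 i) 0))
  unfold conePenalty
  split_ifs <;> linarith

end Penalty

section Instance

variable {m n1 n2 : ℕ}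

/-- The left-hand side `(A x + G y, x, -x)` of the binary conic MIP, on mixed-integer points. -/
noncomputable def mixedIntegerLhs (A : Matrix (Fin m) (Fin n1) ℝ)
    (G : Matrix (Fin m) (Fin n2) ℝ) :
    (Fin n1 → ℤ) × (Fin n2 → ℝ) →+ (Fin m → ℝ) × (Fin n1 → ℝ) × (Fin n1 → ℝ) where
  toFun z := (A.mulVec (fun i => (z.1 i : ℝ)) + G.mulVec z.2, fun i => (z.1 i : ℝ),
    -fun i => (z.1 i : ℝ))
  map_zero' := by
    have : (fun _ => 0 : Fin n1 → ℝ) = 0 := rfl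
    simp [this]
  map_add' z z' := by
    have : (fun i => ((z + z').1 i : ℝ)) = (fun i => (z.1 i : ℝ)) + fun i => (z'.1 i : ℝ) := by
      funext i
      simp
    rw [this]
    refine Prod.ext ?_ (Prod.ext rfl ?_)
    · simp only [Matrix.mulVec_add, Prod.snd_add, Prod.fst_add]; abel
    · simp only [Prod.snd_add, neg_add]

/-- The objective `c·x + d·y` of the binary conic MIP, on mixed-integer points. -/
noncomputable def mixedIntegerCost (c : Fin n1 → ℝ) (d : Fin n2 → ℝ) :
    (Fin n1 → ℤ) × (Fin n2 → ℝ) →+ ℝ where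
  toFun z := (∑ i, c i * z.1 i) + ∑ j, d j * z.2 j
  map_zero' := by simp
  map_add' z z' := by
    simp only [Prod.fst_add, Prod.snd_add, Pi.add_apply, Int.cast_add, mul_add,
      Finset.sum_add_distrib]
    ring

variable {K : Set (Fin m → ℝ)} {A : Matrix (Fin m) (Fin n1) ℝ} {G : Matrix (Fin m) (Fin n2) ℝ}
  {c : Fin n1 → ℝ} {d : Fin n2 → ℝ}

/-- A subadditive monotone function vanishing at the origin that dominates a suitable lower bound
yields a dual feasible function by infimal convolution. -/
lemma binaryDualFeasible_infConv
    {L : (Fin m → ℝ) × (Fin n1 → ℝ) × (Fin n1 → ℝ) → ℝ}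
    (hbdd : ∀ p, BddBelow (Set.range fun z =>
      mixedIntegerCost c d z + L (p - mixedIntegerLhs A G z)))
    (hsub : ∀ u v, L (u + v) ≤ L u + L v) (hmono : ∀ u v, u - v ∈ ConeProd K → L v ≤ L u)
    (h0 : L 0 = 0) :
    BinaryDualFeasible K A G c d (infConv (mixedIntegerLhs A G) (mixedIntegerCost c d) L) := by
  have hmap := infConv_map hbdd hsub h0
  have hcast : ∀ (j : Fin n1) (k : ℤ), (fun i => ((Pi.single j k : Fin n1 → ℤ) i : ℝ)) =
      Pi.single j (k : ℝ) := fun j k => by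
    funext i
    simp only [Pi.single_apply]
    split_ifs <;> simp
  have hx : ∀ (j : Fin n1) (k : ℤ), infConv (mixedIntegerLhs A G) (mixedIntegerCost c d) L
      ((fun i => A i j * k), Pi.single j (k : ℝ), -Pi.single j (k : ℝ)) = c j * k := by
    intro j k
    convert hmap (Pi.single j k, 0) using 2
    · refine Prod.ext ?_ (Prod.ext (hcast j k).symm ?_)
      · funext i
        simp [mixedIntegerLhs, hcast]
      · exact congrArg Neg.neg (hcast j k).symm
    · simp [mixedIntegerCost, Pi.single_apply]
  have hy : ∀ (j : Fin n2) (t : ℝ), infConv (mixedIntegerLhs A G) (mixedIntegerCost c d) L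
      ((fun i => G i j * t), 0, 0) = d j * t := by
    intro j t
    have hz : (fun _ => 0 : Fin n1 → ℝ) = 0 := rfl
    convert hmap (0, Pi.single j t) using 2
    · refine Prod.ext ?_ (Prod.ext ?_ ?_)
      · funext i
        simp [mixedIntegerLhs, hz, mul_comm]
      · simp [mixedIntegerLhs, hz]
      · simp [mixedIntegerLhs, hz]
    · simp [mixedIntegerCost, Pi.single_apply]
  have hbar : ∀ (w : (Fin m → ℝ) × (Fin n1 → ℝ) × (Fin n1 → ℝ)) (a : ℝ),
      (∀ t, infConv (mixedIntegerLhs A G) (mixedIntegerCost c d) L (t • w) = a * t) →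
      fbarP (infConv (mixedIntegerLhs A G) (mixedIntegerCost c d) L) w = (a : EReal) := by
    intro w a h
    refine Tendsto.limsup_eq (tendsto_const_nhds.congr' ?_)
    filter_upwards [self_mem_nhdsWithin] with t ht
    rw [h, mul_div_cancel_right₀ _ (ne_of_gt ht)]
  refine ⟨infConv_add_le hbdd hsub, infConv_mono hbdd hmono, by simpa using hmap 0,
    fun j => ⟨by simpa using hx j 1, ?_⟩, fun j => ⟨hbar _ _ fun t => ?_, hbar _ _ fun t => ?_⟩⟩
  · have := hx j (-1)
    simpa [Pi.single_neg] using this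
  · rw [← hy]
    refine congrArg _ (Prod.ext ?_ (Prod.ext ?_ ?_)) <;> ext i <;> simp [mul_comm]
  · rw [neg_mul, ← mul_neg, ← hy]
    refine congrArg _ (Prod.ext ?_ (Prod.ext ?_ ?_)) <;> ext i <;> simp [mul_comm]

lemma mixedIntegerCost_add_multiplier {μ : (Fin m → ℝ) →ₗ[ℝ] ℝ}
    (hμG : ∀ y, μ (G.mulVec y) = d ⬝ᵥ y) (u : Fin m → ℝ) (z : (Fin n1 → ℤ) × (Fin n2 → ℝ)) :
    mixedIntegerCost c d z + μ (u - (mixedIntegerLhs A G z).1) =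
      μ u + ∑ i, (c i - μ (A.col i)) * z.1 i := by
  have hA : μ (A.mulVec fun i => (z.1 i : ℝ)) = ∑ i, μ (A.col i) * z.1 i := by
    rw [Matrix.mulVec_eq_sum, map_sum]
    refine Finset.sum_congr rfl fun i _ => ?_
    simp [mul_comm]
    exact Or.inl rfl
  simp only [mixedIntegerCost, mixedIntegerLhs, AddMonoidHom.coe_mk, ZeroHom.coe_mk, map_sub,
    map_add, hA, hμG, sub_mul, Finset.sum_sub_distrib, dotProduct]
  ring

end Instance

theorem binary_subadditive_dual_strong
    {m n1 n2 : ℕ} (K : Set (Fin m → ℝ))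
    (A : Matrix (Fin m) (Fin n1) ℝ) (G : Matrix (Fin m) (Fin n2) ℝ)
    (b : Fin m → ℝ) (c : Fin n1 → ℝ) (d : Fin n2 → ℝ)
    (hK : IsRegularCone K)
    (hbdd : BddBelow (BinaryPrimalValues K A G b c d))
    (hstrict : ∃ (x : Fin n1 → ℝ) (y : Fin n2 → ℝ), (∀ i, x i = 0 ∨ x i = 1) ∧
      A.mulVec x + G.mulVec y - b ∈ interior K) :
    ∃ zstar : ℝ, IsGLB (BinaryPrimalValues K A G b c d) zstar ∧
      (∀ F, BinaryDualFeasible K A G c d F →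
        F (b, 0, fun _ => (-1 : ℝ)) ≤ zstar) ∧
      (∃ F, BinaryDualFeasible K A G c d F ∧
        F (b, 0, fun _ => (-1 : ℝ)) = zstar) := by
  obtain ⟨-, hconv, hcone, -, -⟩ := hK
  have hadd : ∀ u ∈ K, ∀ v ∈ K, u + v ∈ K := fun u hu v hv =>
    hconv.add_mem_of_smul_mem hcone hu hv
  obtain ⟨x₀, y₀, hx₀, hs₀⟩ := hstrict
  have hK0 : (0 : Fin m → ℝ) ∈ K := by
    simpa using hcone _ (interior_subset hs₀) 0 le_rfl
  have hne : (BinaryPrimalValues K A G b c d).Nonempty :=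
    ⟨_, x₀, y₀, hx₀, interior_subset hs₀, rfl⟩
  have hglb := isGLB_csInf hne hbdd
  set zstar := sInf (BinaryPrimalValues K A G b c d)
  have hweak : ∀ F, BinaryDualFeasible K A G c d F → F (b, 0, fun _ => (-1 : ℝ)) ≤ zstar :=
    fun F hF => hglb.2 fun v hv => hF.le_of_mem_primalValues hv
  refine ⟨zstar, hglb, hweak, ?_⟩
  obtain ⟨μ, hμK, hμG⟩ := exists_conic_multiplier hconv hcone G d (A.mulVec x₀ - b)
    (zstar - ∑ i, c i * x₀ i)
    (fun y hy => by
      have := hglb.1 ⟨x₀, y, hx₀, by convert hy using 1; abel, rfl⟩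
      simp only [dotProduct]
      linarith)
    y₀ (by convert hs₀ using 1; abel)
  set r : Fin n1 → ℝ := fun i => c i - μ (A.col i) with hr
  set N : ℝ := ∑ i, |r i| with hN
  have hN0 : 0 ≤ N := Finset.sum_nonneg fun i _ => abs_nonneg _
  have hrN : ∀ i, |r i| ≤ N := fun i =>
    Finset.single_le_sum (f := fun i => |r i|) (fun i _ => abs_nonneg _) (Finset.mem_univ i)
  set M : ℝ := |zstar - μ b| + ∑ _i : Fin n1, N * 1 with hM
  have hM0 : 0 ≤ M := by positivity
  -- the box penalty dominates the reduced costs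
  have hbox : ∀ (i : Fin n1) (x v w : ℝ),
      -(N * (|v| + |w|)) ≤ r i * x + N * (max (v - x) 0 + max (w + x) 0) := by
    intro i x v w
    have h1 : -(N * |x|) ≤ r i * x := by
      have h := neg_abs_le (r i * x)
      rw [abs_mul] at h
      have := mul_le_mul_of_nonneg_right (hrN i) (abs_nonneg x)
      linarith
    have h2 : |x| - |v| - |w| ≤ max (v - x) 0 + max (w + x) 0 := by
      have := le_max_left (v - x) 0
      have := le_max_right (v - x) 0
      have := le_max_left (w + x) 0
      have := le_max_right (w + x) 0
      have := neg_abs_le v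
      have := neg_abs_le w
      have := abs_nonneg v
      have := abs_nonneg w
      rcases abs_cases x with ⟨h, _⟩ | ⟨h, _⟩ <;> linarith
    have := mul_le_mul_of_nonneg_left h2 hN0
    linarith
  have hsum : ∀ (p : (Fin m → ℝ) × (Fin n1 → ℝ) × (Fin n1 → ℝ)) z,
      μ p.1 - ∑ i, N * (|p.2.1 i| + |p.2.2 i|) ≤ mixedIntegerCost c d z +
        (μ (p - mixedIntegerLhs A G z).1 + ∑ i, N * (max ((p - mixedIntegerLhs A G z).2.1 i) 0 +
          max ((p - mixedIntegerLhs A G z).2.2 i) 0)) := by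
    intro p z
    rw [← add_assoc, Prod.fst_sub, mixedIntegerCost_add_multiplier hμG, add_assoc,
      ← Finset.sum_add_distrib, sub_eq_add_neg, ← Finset.sum_neg_distrib]
    refine add_le_add le_rfl (Finset.sum_le_sum fun i _ => ?_)
    have := hbox i (z.1 i) (p.2.1 i) (p.2.2 i)
    simpa [mixedIntegerLhs] using this
  have hbddL : ∀ p, BddBelow (Set.range fun z =>
      mixedIntegerCost c d z + conePenalty K μ M N (p - mixedIntegerLhs A G z)) := by
    intro p
    refine ⟨μ p.1 - ∑ i, N * (|p.2.1 i| + |p.2.2 i|), ?_⟩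
    rintro _ ⟨z, rfl⟩
    exact (hsum p z).trans (add_le_add le_rfl (le_conePenalty hM0 _))
  have hfeas := binaryDualFeasible_infConv (K := K) hbddL (conePenalty_add_le hadd hM0 hN0)
    (conePenalty_mono hadd hμK hM0 hN0) (conePenalty_zero hK0)
  refine ⟨_, hfeas, (hweak _ hfeas).antisymm (le_ciInf fun z => ?_)⟩
  by_cases hz : -(((b, 0, fun _ => (-1 : ℝ)) : (Fin m → ℝ) × (Fin n1 → ℝ) × (Fin n1 → ℝ)) -
      mixedIntegerLhs A G z) ∈ ConeProd K
  · have hbin : ∀ i, ((z.1 i : ℤ) : ℝ) = 0 ∨ ((z.1 i : ℤ) : ℝ) = 1 := by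
      intro i
      have h1 := hz.2.1 i
      have h2 := hz.2.2 i
      simp [mixedIntegerLhs] at h1 h2
      have h3 : z.1 i ≤ 1 := by exact_mod_cast (by linarith : ((z.1 i : ℤ) : ℝ) ≤ 1)
      have h4 : z.1 i = 0 ∨ z.1 i = 1 := by omega
      exact h4.imp (fun h => by simp [h]) (fun h => by simp [h])
    have h := hglb.1 ⟨fun i => (z.1 i : ℝ), z.2, hbin,
      by simpa [mixedIntegerLhs] using hz.1, rfl⟩
    exact h.trans (le_add_of_nonneg_right (conePenalty_nonneg hM0 _))
  · have h1 := le_conePenalty_of_notMem (μ := μ) (M := M) (N := N) hz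
    have h2 := hsum (b, 0, fun _ => (-1 : ℝ)) z
    have h3 : μ b - ∑ _i : Fin n1, N * 1 ≤ μ b - ∑ i : Fin n1,
        N * (|(0 : Fin n1 → ℝ) i| + |(-1 : ℝ)|) := by simp
    have h4 := le_abs_self (zstar - μ b)
    simp only at h2
    linarith
end

section
/- Consider the two-block conic MIP with optimal value z* = inf{c·x + d·y : (x,y) ∈ S₁ ∩ S₂, x ∈ ℤ^{n₁}}. Suppose z* is finite, suppose there is a mixed-integer point in int(S₁) ∩ S₂, i.e., int(S₁) ∩ S₂ ∩ (ℤ^{n₁} × ℝ^{n₂}) ≠ ∅, and suppose S₂ is bounded. Then the conic dual of the continuous relaxation is feasible: there exist λ₁ ∈ K₁* and λ₂ ∈ K₂* with A₁ᵀλ₁ + A₂ᵀλ₂ = c and G₁ᵀλ₁ + G₂ᵀλ₂ = d. -/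
/-- `S_i = {(x,y) : A_i x + G_i y - b_i ∈ K_i}` as a subset of `ℝ^{n₁} × ℝ^{n₂}`. -/
def Sblock {m n1 n2 : ℕ} (K : Set (Fin m → ℝ)) (A : Matrix (Fin m) (Fin n1) ℝ)
    (G : Matrix (Fin m) (Fin n2) ℝ) (b : Fin m → ℝ) :
    Set ((Fin n1 → ℝ) × (Fin n2 → ℝ)) :=
  {p | A.mulVec p.1 + G.mulVec p.2 - b ∈ K}

/-- Objective values of the two-block conic MIP
`inf {c·x + d·y : (x,y) ∈ S₁ ∩ S₂, x ∈ ℤ^{n₁}}`. -/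
def TwoBlockValues {m1 m2 n1 n2 : ℕ} (K1 : Set (Fin m1 → ℝ)) (K2 : Set (Fin m2 → ℝ))
    (A1 : Matrix (Fin m1) (Fin n1) ℝ) (G1 : Matrix (Fin m1) (Fin n2) ℝ) (b1 : Fin m1 → ℝ)
    (A2 : Matrix (Fin m2) (Fin n1) ℝ) (G2 : Matrix (Fin m2) (Fin n2) ℝ) (b2 : Fin m2 → ℝ)
    (c : Fin n1 → ℝ) (d : Fin n2 → ℝ) : Set ℝ :=
  {v | ∃ p ∈ Sblock K1 A1 G1 b1 ∩ Sblock K2 A2 G2 b2,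
    (∀ i, ∃ k : ℤ, p.1 i = (k : ℝ)) ∧ v = (∑ i, c i * p.1 i) + ∑ j, d j * p.2 j}

/-- A convex cone other than the whole of a finite-dimensional space, closed or not, lies in a
half-space. -/
theorem PointedCone.exists_strongDual_ne_zero_nonpos {E : Type*} [NormedAddCommGroup E]
    [NormedSpace ℝ E] [FiniteDimensional ℝ E] (C : PointedCone ℝ E) {x : E} (hx : x ∉ C) :
    ∃ f : StrongDual ℝ E, f ≠ 0 ∧ ∀ a ∈ C, f a ≤ 0 := by
  have hconv : Convex ℝ (C : Set E) := C.toConvexCone.convex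
  by_cases hne : (interior (C : Set E)).Nonempty
  · obtain ⟨f, hf, hle⟩ := geometric_hahn_banach_of_nonempty_interior_point hconv
      (fun h => hx (interior_subset h)) hne
    refine ⟨f, hf, fun a ha => ?_⟩
    by_contra! hpos
    obtain ⟨n, hn⟩ := exists_nat_gt (f x / f a)
    have hmem : (n : ℝ) • a ∈ C := C.smul_mem n.cast_nonneg ha
    have h := hle _ hmem
    rw [map_smul, smul_eq_mul] at h
    rw [div_lt_iff₀ hpos] at hn
    linarith
  · have hspan : Submodule.span ℝ (C : Set E) < ⊤ := by
      refine lt_top_iff_ne_top.2 fun h => hne ?_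
      rw [hconv.interior_nonempty_iff_affineSpan_eq_top, ← SetLike.coe_set_eq,
        ← Set.insert_eq_of_mem (show (0 : E) ∈ (C : Set E) from C.zero_mem),
        affineSpan_insert_zero, h]
      rfl
    obtain ⟨f, hf, hker⟩ := Submodule.exists_le_ker_of_lt_top _ hspan
    refine ⟨LinearMap.toContinuousLinearMap f, by simpa using hf, fun a ha => ?_⟩
    exact (LinearMap.mem_ker.1 (hker (Submodule.subset_span ha))).le

/-- If only `0` is sent into the closed cone `K` by the linear map `M`, then every functional
factors as `l ∘ M` with `l` in the dual cone of `K`. -/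
theorem ProperCone.exists_nonneg_comp_eq {E F : Type*} [NormedAddCommGroup E] [NormedSpace ℝ E]
    [FiniteDimensional ℝ E] [NormedAddCommGroup F] [NormedSpace ℝ F]
    (K : ProperCone ℝ F) (M : E →L[ℝ] F) (hM : ∀ r, M r ∈ K → r = 0) (c : StrongDual ℝ E) :
    ∃ l : StrongDual ℝ F, (∀ u ∈ K, 0 ≤ l u) ∧ l.comp M = c := by
  let C : PointedCone ℝ (StrongDual ℝ E) :=
    { carrier := {g | ∃ l : StrongDual ℝ F, (∀ u ∈ K, 0 ≤ l u) ∧ l.comp M = g}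
      zero_mem' := ⟨0, by simp, by simp⟩
      add_mem' := by
        rintro _ _ ⟨l, hl, rfl⟩ ⟨l', hl', rfl⟩
        exact ⟨l + l', fun u hu => add_nonneg (hl u hu) (hl' u hu), by ext; simp⟩
      smul_mem' := by
        rintro ⟨t, ht⟩ _ ⟨l, hl, rfl⟩
        exact ⟨t • l, fun u hu => mul_nonneg ht (hl u hu), by ext; rfl⟩ }
  by_contra hc
  obtain ⟨f, hf, hle⟩ := C.exists_strongDual_ne_zero_nonpos (x := c) hc
  obtain ⟨r, hr⟩ : ∃ r : E, ∀ g : StrongDual ℝ E, f g = g r := by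
    let e : Module.Dual ℝ E ≃ₗ[ℝ] StrongDual ℝ E := LinearMap.toContinuousLinearMap
    obtain ⟨r, hr⟩ := (Module.evalEquiv ℝ E).surjective (f.toLinearMap ∘ₗ e.toLinearMap)
    refine ⟨r, fun g => ?_⟩
    exact (LinearMap.congr_fun hr (e.symm g)).symm
  have hr0 : -r = 0 := by
    apply hM
    by_contra hK
    obtain ⟨l, hl, hneg⟩ := K.hyperplane_separation_point hK
    have h := hle (l.comp M) ⟨l, hl, rfl⟩
    rw [hr] at h
    simp at h hneg
    linarith
  rw [neg_eq_zero] at hr0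
  exact hf (by ext g; simp [hr, hr0])

/-- A vector all of whose nonnegative multiples can be added to a point of a bounded set without
leaving it vanishes. -/
theorem Bornology.IsBounded.eq_zero_of_forall_add_smul_mem {E : Type*} [NormedAddCommGroup E]
    [NormedSpace ℝ E] {S : Set E} (hS : Bornology.IsBounded S) {p r : E}
    (h : ∀ t : ℝ, 0 ≤ t → p + t • r ∈ S) : r = 0 := by
  obtain ⟨R, hR⟩ := hS.exists_norm_le
  by_contra hr
  have hpos := norm_pos_iff.2 hr
  obtain ⟨n, hn⟩ := exists_nat_gt ((R + ‖p‖) / ‖r‖)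
  rw [div_lt_iff₀ hpos] at hn
  have h1 := hR _ (h n n.cast_nonneg)
  have h2 := norm_sub_le (p + (n : ℝ) • r) p
  rw [add_sub_cancel_left, norm_smul, Real.norm_natCast] at h2
  linarith

theorem continuous_dual_feasible_of_bounded_block
    {m1 m2 n1 n2 : ℕ} (K1 : Set (Fin m1 → ℝ)) (K2 : Set (Fin m2 → ℝ))
    (A1 : Matrix (Fin m1) (Fin n1) ℝ) (G1 : Matrix (Fin m1) (Fin n2) ℝ) (b1 : Fin m1 → ℝ)
    (A2 : Matrix (Fin m2) (Fin n1) ℝ) (G2 : Matrix (Fin m2) (Fin n2) ℝ) (b2 : Fin m2 → ℝ)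
    (c : Fin n1 → ℝ) (d : Fin n2 → ℝ)
    (hK1 : IsRegularCone K1) (hK2 : IsRegularCone K2)
    (zstar : ℝ)
    (hzstar : IsGLB (TwoBlockValues K1 K2 A1 G1 b1 A2 G2 b2 c d) zstar)
    (hint : ∃ p, p ∈ interior (Sblock K1 A1 G1 b1) ∧ p ∈ Sblock K2 A2 G2 b2 ∧
      (∀ i, ∃ k : ℤ, p.1 i = (k : ℝ)))
    (hS2bdd : Bornology.IsBounded (Sblock K2 A2 G2 b2)) :
    ∃ (l1 : Fin m1 → ℝ) (l2 : Fin m2 → ℝ),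
      (∀ u ∈ K1, 0 ≤ ∑ i, l1 i * u i) ∧ (∀ u ∈ K2, 0 ≤ ∑ i, l2 i * u i) ∧
      (∀ j, (∑ i, l1 i * A1 i j) + (∑ i, l2 i * A2 i j) = c j) ∧
      (∀ j, (∑ i, l1 i * G1 i j) + (∑ i, l2 i * G2 i j) = d j) := by
  obtain ⟨hclosed, hconv, hsmul, hpt, -⟩ := hK2
  obtain ⟨p, -, hp, -⟩ := hint
  have h0 : (0 : Fin m2 → ℝ) ∈ K2 := (hpt.ge rfl).1
  have hadd : ∀ x ∈ K2, ∀ y ∈ K2, x + y ∈ K2 := fun x hx y hy => by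
    have h := hsmul _ (hconv hx hy (a := 1 / 2) (b := 1 / 2) (by norm_num) (by norm_num)
      (by norm_num)) 2 (by norm_num)
    rwa [smul_add, smul_smul, smul_smul, mul_one_div_cancel two_ne_zero, one_smul,
      one_smul] at h
  let K : ProperCone ℝ (Fin m2 → ℝ) :=
    { carrier := K2
      zero_mem' := h0
      add_mem' := fun hx hy => hadd _ hx _ hy
      smul_mem' := fun t _ hx => hsmul _ hx t t.2
      isClosed' := hclosed }
  let M : ((Fin n1 → ℝ) × (Fin n2 → ℝ)) →L[ℝ] (Fin m2 → ℝ) :=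
    LinearMap.toContinuousLinearMap (A2.mulVecLin.coprod G2.mulVecLin)
  have hM : ∀ r, M r = A2.mulVec r.1 + G2.mulVec r.2 := fun r => rfl
  let obj : StrongDual ℝ ((Fin n1 → ℝ) × (Fin n2 → ℝ)) :=
    LinearMap.toContinuousLinearMap
      ((dotProductBilin ℝ ℝ c).coprod (dotProductBilin ℝ ℝ d))
  have hobj : ∀ r, obj r = c ⬝ᵥ r.1 + d ⬝ᵥ r.2 := fun r => rfl
  obtain ⟨l, hl, hlM⟩ := K.exists_nonneg_comp_eq M (fun r hr => by
    refine hS2bdd.eq_zero_of_forall_add_smul_mem (p := p) fun t ht => ?_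
    have h := hadd _ hp _ (hsmul _ hr t ht)
    have heq : A2.mulVec p.1 + G2.mulVec p.2 - b2 + t • M r =
        A2.mulVec (p + t • r).1 + G2.mulVec (p + t • r).2 - b2 := by
      simp only [hM, Prod.fst_add, Prod.snd_add, Prod.smul_fst, Prod.smul_snd,
        Matrix.mulVec_add, Matrix.mulVec_smul, smul_add]
      abel
    rwa [heq] at h) obj
  have hcoord : ∀ u, l u = ∑ i, l (Pi.single i 1) * u i := fun u => by
    conv_lhs => rw [pi_eq_sum_univ' u, map_sum]
    refine Finset.sum_congr rfl fun i _ => ?_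
    rw [map_smul, smul_eq_mul, mul_comm]
  refine ⟨0, fun i => l (Pi.single i 1), by simp, fun u hu => hcoord u ▸ hl u hu,
    fun j => ?_, fun j => ?_⟩
  · have h := DFunLike.congr_fun hlM (Pi.single j 1, 0)
    rw [ContinuousLinearMap.comp_apply, hM, hobj, hcoord] at h
    simpa using h
  · have h := DFunLike.congr_fun hlM (0, Pi.single j 1)
    rw [ContinuousLinearMap.comp_apply, hM, hobj, hcoord] at h
    simpa using h
end

section
/- Let M ⊆ ℝ^m be a mixed-lattice. If z ∈ M and r belongs to the affine hull of M, then for all ε > 0 and γ ≥ 0 there exists a point w ∈ M whose Euclidean distance to the half-line {z + λr : λ ≥ γ} is less than ε. -/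
/-!
STATEMENT 7: If `M ⊆ ℝ^m` is a mixed-lattice, `z ∈ M` and `r` belongs to the affine
hull of `M`, then for all `ε > 0` and `γ ≥ 0` there exists `w ∈ M` whose Euclidean
distance to the half-line `{z + λ r : λ ≥ γ}` is less than `ε`.
-/

/-- Euclidean distance between two points of `ℝ^n`. -/
noncomputable def eDist {n : ℕ} (u v : Fin n → ℝ) : ℝ :=
  Real.sqrt (∑ i, (u i - v i) ^ 2)

/-- The recession cone of a set `X ⊆ ℝ^n`. -/
def recCone {n : ℕ} (X : Set (Fin n → ℝ)) : Set (Fin n → ℝ) :=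
  {r | ∀ x ∈ X, ∀ t : ℝ, 0 ≤ t → x + t • r ∈ X}

/-- `M ⊆ ℝ^n` is a mixed-lattice: `M = {Ax + By : x ∈ ℤ^{n₁}, y ∈ ℝ^{n₂}}` where
`L = {Ax : x ∈ ℤ^{n₁}}` is a discrete set (hence a discrete additive subgroup, i.e.
a lattice) orthogonal to `V = {By : y ∈ ℝ^{n₂}}`. -/
def IsMixedLattice {n : ℕ} (M : Set (Fin n → ℝ)) : Prop :=
  ∃ (n1 n2 : ℕ) (A : Matrix (Fin n) (Fin n1) ℝ) (B : Matrix (Fin n) (Fin n2) ℝ),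
    M = {z | ∃ (x : Fin n1 → ℤ) (y : Fin n2 → ℝ),
          z = A.mulVec (fun j => (x j : ℝ)) + B.mulVec y} ∧
    (∀ (x : Fin n1 → ℤ) (y : Fin n2 → ℝ),
      ∑ i, (A.mulVec (fun j => (x j : ℝ))) i * (B.mulVec y) i = 0) ∧
    (∃ ε > (0 : ℝ), ∀ x : Fin n1 → ℤ, A.mulVec (fun j => (x j : ℝ)) ≠ 0 →
      ε ≤ eDist (A.mulVec (fun j => (x j : ℝ))) 0)

/-- The Dirichlet approximation property of `P` with respect to `M`: every half-line
`{z + λ r : λ ≥ γ}` with `z ∈ P ∩ M` and `r ∈ rec(P)` has points of `P ∩ M` at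
(Euclidean) distance less than any `ε > 0`. -/
def DirichletAt {n : ℕ} (M P : Set (Fin n → ℝ)) : Prop :=
  ∀ z ∈ P ∩ M, ∀ r ∈ recCone P, ∀ ε > (0 : ℝ), ∀ γ ≥ (0 : ℝ),
    ∃ w ∈ P ∩ M, ∃ lam : ℝ, γ ≤ lam ∧ eDist w (z + lam • r) < ε

/-- A Dirichlet convex set with respect to a mixed-lattice `M`. -/
def IsDirichletConvex {n : ℕ} (M P : Set (Fin n → ℝ)) : Prop :=
  Convex ℝ P ∧ DirichletAt M P

/-- The affine hull of a mixed-lattice consists of real combinations of its generators. -/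
theorem exists_mulVec_add_mulVec_of_mem_affineSpan {m n₁ n₂ : ℕ}
    (A : Matrix (Fin m) (Fin n₁) ℝ) (B : Matrix (Fin m) (Fin n₂) ℝ) {r : Fin m → ℝ}
    (hr : r ∈ affineSpan ℝ {z | ∃ (x : Fin n₁ → ℤ) (y : Fin n₂ → ℝ),
      z = A.mulVec (fun j => (x j : ℝ)) + B.mulVec y}) :
    ∃ (x : Fin n₁ → ℝ) (y : Fin n₂ → ℝ), r = A.mulVec x + B.mulVec y := by
  have hle : affineSpan ℝ {z | ∃ (x : Fin n₁ → ℤ) (y : Fin n₂ → ℝ),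
      z = A.mulVec (fun j => (x j : ℝ)) + B.mulVec y} ≤
      (LinearMap.range (A.mulVecLin.coprod B.mulVecLin)).toAffineSubspace := by
    rw [affineSpan_le]
    rintro _ ⟨x, y, rfl⟩
    exact ⟨(fun j => (x j : ℝ), y), by simp⟩
  obtain ⟨⟨x, y⟩, hxy⟩ := hle hr
  exact ⟨x, y, by simpa using hxy.symm⟩

/-- Among the fractional parts of the natural multiples of a real vector, two have images under a
matrix that are arbitrarily close. -/
theorem exists_lt_eDist_mulVec_fract_lt {m n : ℕ} (A : Matrix (Fin m) (Fin n) ℝ)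
    (t : Fin n → ℝ) {ε : ℝ} (hε : 0 < ε) :
    ∃ k l : ℕ, k < l ∧ eDist (A.mulVec fun j => Int.fract (k * t j))
      (A.mulVec fun j => Int.fract (l * t j)) < ε := by
  obtain ⟨a, -, φ, hφ, hlim⟩ := (isCompact_Icc (a := (0 : Fin n → ℝ)) (b := 1)).tendsto_subseq
    (x := fun (k : ℕ) (j : Fin n) => Int.fract (k * t j))
    fun k => ⟨fun j => Int.fract_nonneg _, fun j => (Int.fract_lt_one _).le⟩
  have hcont : Continuous fun p : (Fin n → ℝ) × (Fin n → ℝ) =>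
      eDist (A.mulVec p.1) (A.mulVec p.2) := by
    unfold eDist
    simp only [Matrix.mulVec, dotProduct]
    fun_prop
  have hdist := (hcont.tendsto (a, a)).comp
    (hlim.prodMk_nhds (hlim.comp (Filter.tendsto_add_atTop_nat 1)))
  have hzero : eDist (A.mulVec a) (A.mulVec a) = 0 := by simp [eDist]
  rw [hzero] at hdist
  obtain ⟨i, hi⟩ := (hdist.eventually_lt_const hε).exists
  exact ⟨φ i, φ (i + 1), hφ i.lt_succ_self, hi⟩

theorem mixedLattice_halfline_approx {m : ℕ} (M : Set (Fin m → ℝ))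
    (hM : IsMixedLattice M) (z : Fin m → ℝ) (hz : z ∈ M)
    (r : Fin m → ℝ) (hr : r ∈ affineSpan ℝ M) :
    ∀ ε > (0 : ℝ), ∀ γ ≥ (0 : ℝ),
      ∃ w ∈ M, ∃ lam : ℝ, γ ≤ lam ∧ eDist w (z + lam • r) < ε := by
  intro ε hε γ hγ
  obtain ⟨n₁, n₂, A, B, rfl, -, -⟩ := hM
  obtain ⟨x, y, rfl⟩ := exists_mulVec_add_mulVec_of_mem_affineSpan A B hr
  obtain ⟨p, q, rfl⟩ := hz
  obtain ⟨k, l, hkl, hlt⟩ := exists_lt_eDist_mulVec_fract_lt A (γ • x) hε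
  have hkl' : (k : ℝ) + 1 ≤ l := by exact_mod_cast hkl
  refine ⟨_, ⟨fun j => p j + (⌊l * (γ • x) j⌋ - ⌊k * (γ • x) j⌋),
    q + ((l - k) * γ) • y, rfl⟩, (l - k) * γ, by nlinarith, ?_⟩
  have hsplit : (fun j => ((p j + (⌊l * (γ • x) j⌋ - ⌊k * (γ • x) j⌋) : ℤ) : ℝ)) =
      (fun j => (p j : ℝ)) + ((l - k) * γ) • x +
        ((fun j => Int.fract (k * (γ • x) j)) - fun j => Int.fract (l * (γ • x) j)) := by
    funext j
    simp only [Int.fract, Pi.add_apply, Pi.sub_apply, Pi.smul_apply, smul_eq_mul]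
    push_cast
    ring
  rw [hsplit]
  refine lt_of_eq_of_lt ?_ hlt
  unfold eDist
  congr 1
  refine Finset.sum_congr rfl fun i _ => ?_
  simp only [Matrix.mulVec_add, Matrix.mulVec_sub, Matrix.mulVec_smul, Pi.add_apply,
    Pi.sub_apply, Pi.smul_apply, smul_eq_mul]
  ring
end

section
/- Let M ⊆ ℝ^n be a mixed-lattice and let X ⊆ ℝ^n be a Dirichlet convex set with respect to M. Let T : ℝ^n → ℝ^n be an invertible affine mapping, T(x) = Nx + t with N an invertible n×n real matrix and t ∈ ℝ^n, such that T(M) = M. Then the image T(X) is a Dirichlet convex set with respect to M. -/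
/-- A linear map is Lipschitz for the Euclidean distance, with its Frobenius norm as constant. -/
theorem eDist_mulVec_add_le {n : ℕ} (N : Matrix (Fin n) (Fin n) ℝ) (t u v : Fin n → ℝ) :
    eDist (N.mulVec u + t) (N.mulVec v + t) ≤
      Real.sqrt (∑ i, ∑ j, N i j ^ 2) * eDist u v := by
  unfold eDist
  rw [← Real.sqrt_mul (by positivity)]
  refine Real.sqrt_le_sqrt ?_
  rw [Finset.sum_mul]
  refine Finset.sum_le_sum fun i _ => ?_
  have h : (N.mulVec u + t) i - (N.mulVec v + t) i = ∑ j, N i j * (u j - v j) := by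
    simp [Matrix.mulVec, dotProduct, mul_sub, Finset.sum_sub_distrib]
  rw [h]
  exact Finset.sum_mul_sq_le_sq_mul_sq _ _ _

/-- An invertible affine map pulls recession directions of the image back to recession
directions. -/
theorem mem_recCone_of_mulVec_mem_recCone_image {n : ℕ} {N : Matrix (Fin n) (Fin n) ℝ}
    {t : Fin n → ℝ} {X : Set (Fin n → ℝ)} (hN : Function.Injective N.mulVec) {r : Fin n → ℝ}
    (hr : N.mulVec r ∈ recCone ((fun x => N.mulVec x + t) '' X)) : r ∈ recCone X := by
  intro x hx s hs
  obtain ⟨y, hy, hyx⟩ := hr _ ⟨x, hx, rfl⟩ s hs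
  have h : N.mulVec y = N.mulVec (x + s • r) := by
    rw [Matrix.mulVec_add, Matrix.mulVec_smul]
    refine add_right_cancel (b := t) ?_
    rw [add_right_comm]
    exact hyx
  exact hN h ▸ hy

theorem dirichlet_affine_image {n : ℕ} (M X : Set (Fin n → ℝ))
    (hM : IsMixedLattice M) (hX : IsDirichletConvex M X)
    (N : Matrix (Fin n) (Fin n) ℝ) (t : Fin n → ℝ) (hN : IsUnit N)
    (hTM : (fun x => N.mulVec x + t) '' M = M) :
    IsDirichletConvex M ((fun x => N.mulVec x + t) '' X) := by
  have hinj : Function.Injective N.mulVec := Matrix.mulVec_injective_of_isUnit hN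
  obtain ⟨hconv, hdir⟩ := hX
  refine ⟨?_, ?_⟩
  · have h := (hconv.linear_image N.mulVecLin).translate t
    rw [Set.image_image] at h
    simpa only [Matrix.mulVecLin_apply, add_comm t] using h
  · rintro _ ⟨⟨z, hzX, rfl⟩, hzM⟩ r hr ε hε γ hγ
    rw [← hTM] at hzM
    obtain ⟨z', hz'M, hz'⟩ := hzM
    obtain rfl : z' = z := hinj (add_right_cancel hz')
    obtain ⟨q, rfl⟩ : ∃ q, N.mulVec q = r := Matrix.mulVec_surjective_iff_isUnit.2 hN r
    set C := Real.sqrt (∑ i, ∑ j, N i j ^ 2)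
    have hC : 0 ≤ C := Real.sqrt_nonneg _
    obtain ⟨w, ⟨hwX, hwM⟩, lam, hlam, hw⟩ := hdir z' ⟨hzX, hz'M⟩ q
      (mem_recCone_of_mulVec_mem_recCone_image hinj hr) (ε / (C + 1)) (by positivity) γ hγ
    refine ⟨N.mulVec w + t, ⟨⟨w, hwX, rfl⟩, hTM ▸ ⟨w, hwM, rfl⟩⟩, lam, hlam, ?_⟩
    have h : N.mulVec z' + t + lam • N.mulVec q = N.mulVec (z' + lam • q) + t := by
      rw [Matrix.mulVec_add, Matrix.mulVec_smul, add_right_comm]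
    have hd : 0 ≤ eDist w (z' + lam • q) := Real.sqrt_nonneg _
    rw [lt_div_iff₀ (by positivity)] at hw
    calc eDist (N.mulVec w + t) (N.mulVec z' + t + lam • N.mulVec q)
        ≤ C * eDist w (z' + lam • q) := h ▸ eDist_mulVec_add_le N t w _
      _ < ε := by linarith
end

section
/- Let M ⊆ ℝ^n be a mixed-lattice and let X ⊆ ℝ^n be a convex set such that rec(X) = rec(conv(X ∩ M)). Then X is a Dirichlet convex set with respect to M. -/
open Filter Topology in
/-- Simultaneous Dirichlet approximation with an arbitrarily large multiplier. -/
theorem exists_nat_mul_sub_int_norm_lt {ι : Type*} [Fintype ι] (a : ι → ℝ) {δ : ℝ}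
    (hδ : 0 < δ) (K : ℕ) :
    ∃ k : ℕ, K ≤ k ∧ ∃ p : ι → ℤ, ‖fun i => (p i : ℝ) - k * a i‖ < δ := by
  have hcpt : IsCompact (Set.Icc (0 : ι → ℝ) 1) := isCompact_Icc
  obtain ⟨b, -, φ, hφ, hlim⟩ := hcpt.tendsto_subseq
    (x := fun (k : ℕ) i => Int.fract ((k : ℝ) * a i))
    fun k => ⟨fun i => Int.fract_nonneg _, fun i => (Int.fract_lt_one _).le⟩
  obtain ⟨N, hN⟩ := Metric.cauchySeq_iff.mp hlim.cauchySeq δ hδ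
  have hlow : φ N + K ≤ φ (φ N + K + N) := by
    have := hφ.id_le (φ N + K + N)
    simp only [id] at this
    omega
  refine ⟨φ (φ N + K + N) - φ N, by omega,
    fun i => ⌊(φ (φ N + K + N) : ℝ) * a i⌋ - ⌊(φ N : ℝ) * a i⌋, ?_⟩
  have hdist := hN N le_rfl (φ N + K + N) (by omega)
  rw [dist_eq_norm] at hdist
  refine lt_of_eq_of_lt (congrArg _ (funext fun i => ?_)) hdist
  simp only [Pi.sub_apply, Function.comp_apply, Int.fract]
  rw [Nat.cast_sub (by omega)]
  push_cast
  ring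

/-- A mixed-lattice is an additive subgroup of `ℝ^n`. -/
theorem IsMixedLattice.exists_addSubgroup {n : ℕ} {M : Set (Fin n → ℝ)}
    (hM : IsMixedLattice M) : ∃ G : AddSubgroup (Fin n → ℝ), (G : Set (Fin n → ℝ)) = M := by
  obtain ⟨n1, n2, A, B, rfl, -, -⟩ := hM
  refine ⟨{ carrier := _, add_mem' := ?_, zero_mem' := ?_, neg_mem' := ?_ }, rfl⟩
  · rintro _ _ ⟨x, y, rfl⟩ ⟨x', y', rfl⟩
    refine ⟨x + x', y + y', ?_⟩
    have : (fun j => ((x + x') j : ℝ)) = (fun j => (x j : ℝ)) + fun j => (x' j : ℝ) := by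
      ext j; simp
    rw [this, Matrix.mulVec_add, Matrix.mulVec_add]
    abel
  · refine ⟨0, 0, ?_⟩
    have : (fun j => ((0 : Fin n1 → ℤ) j : ℝ)) = 0 := by ext j; simp
    rw [this, Matrix.mulVec_zero, Matrix.mulVec_zero, add_zero]
  · rintro _ ⟨x, y, rfl⟩
    refine ⟨-x, -y, ?_⟩
    have : (fun j => ((-x) j : ℝ)) = -fun j => (x j : ℝ) := by ext j; simp
    rw [this, Matrix.mulVec_neg, Matrix.mulVec_neg, neg_add]

theorem Convex.add_sum_smul_sub_mem {E ι : Type*} [AddCommGroup E] [Module ℝ E] [Fintype ι]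
    {X : Set E} (hX : Convex ℝ X) {z : E} (hz : z ∈ X) {s : ι → E} (hs : ∀ i, s i ∈ X)
    {c : ι → ℝ} (hc : ∀ i, 0 ≤ c i) (hc1 : ∑ i, c i ≤ 1) :
    z + ∑ i, c i • (s i - z) ∈ X := by
  have h := hX.sum_mem (t := Finset.univ) (w := fun o : Option ι => o.elim (1 - ∑ i, c i) c)
    (z := fun o => o.elim z s)
    (by rintro (_ | i) -; exacts [sub_nonneg.mpr hc1, hc i])
    (by simp [Fintype.sum_option])
    (by rintro (_ | i) -; exacts [hz, hs i])
  convert h using 1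
  simp only [Fintype.sum_option, Option.elim, smul_sub, Finset.sum_sub_distrib, sub_smul, one_smul,
    Finset.sum_smul]
  abel

open Filter Topology in
/-- If every recession direction of the convex set `X` is one of `conv(X ∩ G)`, with `G` an
additive subgroup, then `X` has the Dirichlet approximation property with respect to `G`. -/
theorem dirichletAt_of_recCone_subset {n : ℕ} (G : AddSubgroup (Fin n → ℝ))
    {X : Set (Fin n → ℝ)} (hX : Convex ℝ X)
    (hrec : recCone X ⊆ recCone (convexHull ℝ (X ∩ G))) : DirichletAt G X := by
  rintro z ⟨hzX, hzG⟩ r hr ε hε γ -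
  have hmem := hrec hr z (subset_convexHull ℝ _ ⟨hzX, hzG⟩) 2 (by norm_num)
  obtain ⟨ι, _, s, μ, hs, -, hμ, hμ1, hsum⟩ := eq_pos_convex_span_of_mem_convexHull hmem
  have hs' : ∀ i, s i ∈ X ∩ G := fun i => hs (Set.mem_range_self i)
  -- The direction `r` is a positive combination of the vectors `s i - z` of total weight `1 / 2`.
  set a : ι → ℝ := fun i => μ i / 2 with ha
  have ha0 : ∀ i, 0 < a i := fun i => half_pos (hμ i)
  have ha1 : ∑ i, a i = 1 / 2 := by rw [ha, ← Finset.sum_div, hμ1]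
  have hra : r = ∑ i, a i • (s i - z) := by
    have h2 : (2 : ℝ) • r = ∑ i, μ i • (s i - z) := by
      simp only [smul_sub, Finset.sum_sub_distrib, ← Finset.sum_smul, hμ1, hsum]
      simp
    calc r = (1 / 2 : ℝ) • (2 : ℝ) • r := by rw [smul_smul]; norm_num
      _ = _ := by
        rw [h2, Finset.smul_sum]
        refine Finset.sum_congr rfl fun i _ => ?_
        rw [smul_smul, ha]
        congr 1
        ring
  have hpos : ∀ᶠ e : ι → ℝ in 𝓝 0, ∀ i, 0 < a i + e i := by
    refine eventually_all.mpr fun i => ?_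
    have hc : Continuous fun e : ι → ℝ => a i + e i := by fun_prop
    exact hc.continuousAt.eventually_const_lt (by simpa using ha0 i)
  have hle : ∀ᶠ e : ι → ℝ in 𝓝 0, ∑ i, (a i + e i) < 1 := by
    have hc : Continuous fun e : ι → ℝ => ∑ i, (a i + e i) := by fun_prop
    exact hc.continuousAt.eventually_lt_const (by simp [ha1]; norm_num)
  have hdist : ∀ᶠ e : ι → ℝ in 𝓝 0, eDist (∑ i, e i • (s i - z)) 0 < ε := by
    have hc : Continuous fun e : ι → ℝ => eDist (∑ i, e i • (s i - z)) 0 := by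
      unfold eDist
      fun_prop
    exact hc.continuousAt.eventually_lt_const (by simpa [eDist] using hε)
  obtain ⟨δ, hδ, hball⟩ := Metric.eventually_nhds_iff.mp (hpos.and (hle.and hdist))
  obtain ⟨k, hk, p, hp⟩ := exists_nat_mul_sub_int_norm_lt a hδ (⌈γ⌉₊ + 1)
  set e : ι → ℝ := fun i => (p i : ℝ) - k * a i with he
  obtain ⟨hpos, hle, hdist⟩ := hball (y := e) (by rwa [dist_zero_right])
  have hw : z + ∑ i, p i • (s i - z) = z + (k : ℝ) • r + ∑ i, e i • (s i - z) := by
    rw [add_assoc, hra, Finset.smul_sum, ← Finset.sum_add_distrib]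
    congr 1
    refine Finset.sum_congr rfl fun i _ => ?_
    rw [smul_smul, ← add_smul, he, ← Int.cast_smul_eq_zsmul ℝ]
    congr 1
    ring
  have hk1 : (⌈γ⌉₊ : ℝ) + 1 ≤ k := by exact_mod_cast hk
  refine ⟨z + ∑ i, p i • (s i - z), ⟨?_, ?_⟩, k, by linarith [Nat.le_ceil γ], ?_⟩
  · have h := hr _ (hX.add_sum_smul_sub_mem hzX (fun i => (hs' i).1) (fun i => (hpos i).le) hle.le)
      ((k : ℝ) - 1) (by linarith [Nat.cast_nonneg (α := ℝ) ⌈γ⌉₊])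
    convert h using 1
    simp only [hw, add_smul, Finset.sum_add_distrib, ← hra, sub_smul, one_smul]
    abel
  · exact G.add_mem hzG (G.sum_mem fun i _ => G.zsmul_mem (G.sub_mem (hs' i).2 hzG) _)
  · rw [hw]
    convert hdist using 1
    simp [eDist]

theorem dirichlet_of_recCone_eq {n : ℕ} (M X : Set (Fin n → ℝ))
    (hM : IsMixedLattice M) (hX : Convex ℝ X)
    (hrec : recCone X = recCone (convexHull ℝ (X ∩ M))) :
    IsDirichletConvex M X := by
  obtain ⟨G, rfl⟩ := hM.exists_addSubgroup
  exact ⟨hX, dirichletAt_of_recCone_subset G hX hrec.subset⟩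
end

section
/- Every rational polyhedron X = {z ∈ ℝ^{n₁+n₂} : Cz ≥ e}, where the matrix C and the vector e have all entries rational, is a Dirichlet convex set with respect to the mixed-lattice ℤ^{n₁} × ℝ^{n₂}. -/
/-- The mixed-lattice `ℤ^{n₁} × ℝ^{n₂}` inside `ℝ^{n₁+n₂}`: the first `n₁`
coordinates are integers. -/
def Zmix (n1 n2 : ℕ) : Set (Fin (n1 + n2) → ℝ) :=
  {z | ∀ i : Fin (n1 + n2), (i : ℕ) < n1 → ∃ k : ℤ, z i = (k : ℝ)}

/-- Simultaneous Dirichlet approximation with an arbitrarily large denominator. -/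
theorem exists_nat_ge_simultaneous_approx {ι : Type*} [Fintype ι] (a : ι → ℝ) (N : ℕ)
    {δ : ℝ} (hδ : 0 < δ) :
    ∃ q : ℕ, N ≤ q ∧ ∃ p : ι → ℤ, ∀ j, |(p j : ℝ) - q * a j| < δ := by
  obtain ⟨x, -, φ, hφ, hx⟩ := (isCompact_univ_pi fun _ : ι => isCompact_Icc).tendsto_subseq
    (x := fun (m : ℕ) (j : ι) => Int.fract (m * a j))
    (fun m j _ => ⟨Int.fract_nonneg _, (Int.fract_lt_one (m * a j)).le⟩)
  obtain ⟨m, hm⟩ := Metric.cauchySeq_iff'.1 hx.cauchySeq δ hδ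
  have hle : φ m ≤ φ (φ m + N + m) := hφ.monotone (by omega)
  have hge : φ m + N + m ≤ φ (φ m + N + m) := hφ.id_le _
  refine ⟨φ (φ m + N + m) - φ m, by omega,
    fun j => ⌊φ (φ m + N + m) * a j⌋ - ⌊φ m * a j⌋, fun j => ?_⟩
  have h := (dist_le_pi_dist _ _ j).trans_lt (hm (φ m + N + m) (by omega))
  rw [Real.dist_eq, abs_sub_comm] at h
  refine lt_of_eq_of_lt (congrArg _ ?_) h
  simp only [Function.comp_apply, Int.fract]
  push_cast [Nat.cast_sub hle]
  ring

/-- A real vector has arbitrarily large multiples that are close to integer vectors satisfying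
every rational linear equation satisfied by the given vector. -/
theorem exists_int_vector_near_multiple {n : ℕ} (r : Fin n → ℝ) (γ : ℝ) {δ : ℝ} (hδ : 0 < δ) :
    ∃ lam : ℝ, γ ≤ lam ∧ ∃ d : Fin n → ℤ, (∀ i, |(d i : ℝ) - lam * r i| < δ) ∧
      ∀ c : Fin n → ℚ, ∑ i, (c i : ℝ) * r i = 0 → ∑ i, (c i : ℝ) * d i = 0 := by
  let G := Submodule.span ℤ (Set.range r)
  have : Module.Finite ℤ G := Module.Finite.span_of_finite ℤ (Set.finite_range r)
  obtain ⟨m, b⟩ := Module.basisOfFiniteTypeTorsionFree' (R := ℤ) (M := G)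
  let a : Fin m → ℝ := fun j => b j
  let v : Fin n → Fin m → ℤ := fun i j => b.repr ⟨r i, Submodule.subset_span ⟨i, rfl⟩⟩ j
  have hr (i) : r i = ∑ j, (v i j : ℝ) * a j := by
    have h := congrArg G.subtype (b.sum_repr ⟨r i, Submodule.subset_span ⟨i, rfl⟩⟩)
    rw [map_sum] at h
    simp only [map_zsmul, zsmul_eq_mul] at h
    exact h.symm
  have ha : LinearIndependent ℚ a := by
    rw [← LinearIndependent.iff_fractionRing (R := ℤ) (K := ℚ)]
    exact b.linearIndependent.map' G.subtype (Submodule.ker_subtype _)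
  have hpos : 0 < 1 + ∑ i, ∑ j, |(v i j : ℝ)| := by positivity
  obtain ⟨q, hq, p, hp⟩ := exists_nat_ge_simultaneous_approx a ⌈γ⌉₊ (div_pos hδ hpos)
  refine ⟨q, (Nat.le_ceil γ).trans (by exact_mod_cast hq), fun i => ∑ j, v i j * p j,
    fun i => ?_, fun c hc => ?_⟩
  · have h : ((∑ j, v i j * p j : ℤ) : ℝ) - q * r i = ∑ j, v i j * (p j - q * a j) := by
      rw [hr, Finset.mul_sum]
      push_cast
      rw [← Finset.sum_sub_distrib]
      exact Finset.sum_congr rfl fun j _ => by ring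
    rw [h]
    calc |∑ j, (v i j : ℝ) * (p j - q * a j)|
        ≤ ∑ j, |(v i j : ℝ) * (p j - q * a j)| := Finset.abs_sum_le_sum_abs _ _
      _ ≤ ∑ j, |(v i j : ℝ)| * (δ / (1 + ∑ i, ∑ j, |(v i j : ℝ)|)) :=
          Finset.sum_le_sum fun j _ => by
            rw [abs_mul]
            exact mul_le_mul_of_nonneg_left (hp j).le (abs_nonneg _)
      _ = (∑ j, |(v i j : ℝ)|) * (δ / (1 + ∑ i, ∑ j, |(v i j : ℝ)|)) := by
          rw [Finset.sum_mul]
      _ < (1 + ∑ i, ∑ j, |(v i j : ℝ)|) * (δ / (1 + ∑ i, ∑ j, |(v i j : ℝ)|)) := by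
          refine mul_lt_mul_of_pos_right ?_ (div_pos hδ hpos)
          have := Finset.single_le_sum (f := fun i => ∑ j, |(v i j : ℝ)|)
            (fun i _ => by positivity) (Finset.mem_univ i)
          linarith
      _ = δ := mul_div_cancel₀ _ hpos.ne'
  · have hzero : ∀ j, ∑ i, c i * v i j = 0 := by
      refine Fintype.linearIndependent_iff.1 ha _ ?_
      rw [← hc]
      simp only [hr, Finset.mul_sum, Rat.smul_def]
      rw [Finset.sum_comm]
      refine Finset.sum_congr rfl fun j _ => ?_
      push_cast
      rw [Finset.sum_mul]
      exact Finset.sum_congr rfl fun i _ => by ring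
    have hzero' (j) : ∑ i, (c i : ℝ) * v i j = 0 := by exact_mod_cast hzero j
    push_cast
    simp only [Finset.mul_sum]
    rw [Finset.sum_comm]
    refine Finset.sum_eq_zero fun j _ => ?_
    simp only [← mul_assoc]
    rw [← Finset.sum_mul, hzero', zero_mul]

theorem mulVec_nonneg_of_mem_recCone {n k : ℕ} {C : Matrix (Fin k) (Fin n) ℝ} {e : Fin k → ℝ}
    {z r : Fin n → ℝ} (hz : z ∈ {z | ∀ i, e i ≤ C.mulVec z i})
    (hr : r ∈ recCone {z | ∀ i, e i ≤ C.mulVec z i}) (i : Fin k) : 0 ≤ C.mulVec r i := by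
  by_contra! h
  have hz' := hz i
  have ht : 0 ≤ (C.mulVec z i - e i + 1) / -C.mulVec r i :=
    div_nonneg (by linarith) (by linarith)
  have h1 := hr z hz _ ht i
  rw [Matrix.mulVec_add, Matrix.mulVec_smul, Pi.add_apply, Pi.smul_apply, smul_eq_mul,
    div_mul_eq_mul_div, div_neg, mul_div_cancel_right₀ _ h.ne] at h1
  linarith

theorem eDist_le_sum_abs {n : ℕ} (u v : Fin n → ℝ) : eDist u v ≤ ∑ i, |u i - v i| := by
  refine Real.sqrt_le_iff.2 ⟨by positivity, ?_⟩
  simpa only [sq_abs] using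
    Finset.sum_sq_le_sq_sum_of_nonneg (s := Finset.univ) fun i _ => abs_nonneg (u i - v i)

theorem rational_polyhedron_isDirichlet {n1 n2 k : ℕ}
    (C : Matrix (Fin k) (Fin (n1 + n2)) ℝ) (e : Fin k → ℝ)
    (hC : ∀ i j, ∃ q : ℚ, C i j = (q : ℝ)) (he : ∀ i, ∃ q : ℚ, e i = (q : ℝ)) :
    IsDirichletConvex (Zmix n1 n2) {z | ∀ i, e i ≤ C.mulVec z i} := by
  refine ⟨fun x hx y hy a b ha hb hab i => ?_, ?_⟩
  · rw [Matrix.mulVec_add, Matrix.mulVec_smul, Matrix.mulVec_smul]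
    calc e i = a * e i + b * e i := by rw [← add_mul, hab, one_mul]
      _ ≤ a * C.mulVec x i + b * C.mulVec y i :=
        add_le_add (mul_le_mul_of_nonneg_left (hx i) ha) (mul_le_mul_of_nonneg_left (hy i) hb)
  rintro z ⟨hzP, hzM⟩ r hr ε hε γ hγ
  choose c hc using hC
  have hn : (0 : ℝ) < (n1 + n2 : ℕ) + 1 := by positivity
  have hδ : 0 < min 1 (ε / ((n1 + n2 : ℕ) + 1)) := lt_min one_pos (div_pos hε hn)
  obtain ⟨lam, hlam, d, hd, hd0⟩ := exists_int_vector_near_multiple r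
    (γ + ∑ i, (∑ j, |C i j|) / C.mulVec r i) hδ
  have hCr := mulVec_nonneg_of_mem_recCone hzP hr
  have hquot (i : Fin k) : 0 ≤ (∑ j, |C i j|) / C.mulVec r i :=
    div_nonneg (by positivity) (hCr i)
  have hCd (i : Fin k) : 0 ≤ C.mulVec (fun j => (d j : ℝ)) i := by
    rcases (hCr i).eq_or_lt with h | h
    · have h0 := hd0 (c i) (by
        simp only [← hc]
        exact h.symm)
      simp only [← hc] at h0
      exact h0.ge
    · have hsplit : C.mulVec (fun j => (d j : ℝ)) i
          = lam * C.mulVec r i + ∑ j, C i j * (d j - lam * r j) := by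
        simp only [Matrix.mulVec, dotProduct, Finset.mul_sum, ← Finset.sum_add_distrib]
        exact Finset.sum_congr rfl fun j _ => by ring
      have herr : -∑ j, |C i j| ≤ ∑ j, C i j * (d j - lam * r j) := by
        rw [← Finset.sum_neg_distrib]
        refine Finset.sum_le_sum fun j _ => (abs_le.1 ?_).1
        rw [abs_mul]
        exact mul_le_of_le_one_right (abs_nonneg _) ((hd j).le.trans (min_le_left _ _))
      have hlarge : ∑ j, |C i j| ≤ lam * C.mulVec r i := by
        rw [← div_le_iff₀ h]
        have := Finset.single_le_sum (fun i _ => hquot i) (Finset.mem_univ i)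
        linarith
      linarith
  refine ⟨z + fun j => (d j : ℝ), ⟨fun i => ?_, fun i hi => ?_⟩, lam, ?_, ?_⟩
  · rw [Matrix.mulVec_add, Pi.add_apply]
    linarith [hzP i, hCd i]
  · obtain ⟨m, hm⟩ := hzM i hi
    exact ⟨m + d i, by simp [hm]⟩
  · linarith [Finset.sum_nonneg fun i (_ : i ∈ Finset.univ) => hquot i]
  · calc eDist (z + fun j => (d j : ℝ)) (z + lam • r)
        ≤ ∑ i, |(d i : ℝ) - lam * r i| := by
          simpa using eDist_le_sum_abs (z + fun j => (d j : ℝ)) (z + lam • r)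
      _ ≤ ∑ _i : Fin (n1 + n2), ε / ((n1 + n2 : ℕ) + 1) :=
          Finset.sum_le_sum fun i _ => (hd i).le.trans (min_le_right _ _)
      _ = (n1 + n2 : ℕ) * (ε / ((n1 + n2 : ℕ) + 1)) := by simp
      _ < ((n1 + n2 : ℕ) + 1) * (ε / ((n1 + n2 : ℕ) + 1)) :=
          mul_lt_mul_of_pos_right (lt_add_one _) (div_pos hε hn)
      _ = ε := mul_div_cancel₀ _ hn.ne'
end

section
/- Every closed strictly convex set X ⊆ ℝ^{n₁+n₂} (a closed convex set such that for any two distinct points x, y ∈ X, the open segment between x and y is contained in the interior of X) is a Dirichlet convex set with respect to the mixed-lattice ℤ^{n₁} × ℝ^{n₂}. -/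
/-- Simultaneous Dirichlet approximation: arbitrarily far multiples of a vector come
arbitrarily close to the integer lattice. -/
theorem exists_smul_near_int {n : ℕ} (r : Fin n → ℝ) {η : ℝ} (hη : 0 < η) (T : ℝ)
    (hT : 0 ≤ T) :
    ∃ lam : ℝ, T ≤ lam ∧ ∃ p : Fin n → ℤ, ‖(fun i => (p i : ℝ)) - lam • r‖ < η := by
  let f : ℕ → Fin n → ℝ := fun k i => Int.fract ((k : ℝ) * T * r i)
  have hf : ∀ k, f k ∈ Set.Icc (0 : Fin n → ℝ) 1 := fun k =>
    ⟨fun _ => Int.fract_nonneg _, fun _ => (Int.fract_lt_one _).le⟩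
  obtain ⟨a, -, φ, hφ, hlim⟩ := isCompact_Icc.tendsto_subseq hf
  obtain ⟨N, hN⟩ := Metric.cauchySeq_iff'.1 hlim.cauchySeq η hη
  have hd := hN (N + 1) (Nat.le_succ N)
  have hlt : (φ N : ℝ) + 1 ≤ φ (N + 1) := by exact_mod_cast hφ (Nat.lt_succ_self N)
  refine ⟨((φ (N + 1) : ℝ) - φ N) * T, by nlinarith,
    fun i => ⌊(φ (N + 1) : ℝ) * T * r i⌋ - ⌊(φ N : ℝ) * T * r i⌋, ?_⟩
  rw [dist_comm, dist_eq_norm] at hd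
  refine lt_of_eq_of_lt (congrArg norm (funext fun i => ?_)) hd
  simp only [f, Function.comp_apply, Pi.sub_apply, Pi.smul_apply, smul_eq_mul, Int.fract]
  push_cast
  ring

theorem exists_norm_lt_eDist_lt (n : ℕ) {ε : ℝ} (hε : 0 < ε) :
    ∃ η > (0 : ℝ), ∀ u v : Fin n → ℝ, ‖u - v‖ < η → eDist u v < ε := by
  have hc : Continuous fun w : Fin n → ℝ => Real.sqrt (∑ i, w i ^ 2) := by fun_prop
  obtain ⟨η, hη, h⟩ := Metric.continuousAt_iff.1 (hc.continuousAt (x := 0)) ε hε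
  refine ⟨η, hη, fun u v huv => ?_⟩
  have := h (x := u - v) (by simpa using huv)
  simpa [eDist, Real.dist_eq, abs_of_nonneg (Real.sqrt_nonneg _)] using this

theorem strictly_convex_isDirichlet {n1 n2 : ℕ} (X : Set (Fin (n1 + n2) → ℝ))
    (hXcl : IsClosed X) (hXconv : Convex ℝ X)
    (hstrict : ∀ x ∈ X, ∀ y ∈ X, x ≠ y → ∀ t : ℝ, 0 < t → t < 1 →
      t • x + (1 - t) • y ∈ interior X) :
    IsDirichletConvex (Zmix n1 n2) X := by
  refine ⟨hXconv, ?_⟩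
  rintro z ⟨hzX, hzM⟩ r hr ε hε γ -
  obtain ⟨η, hη, hη'⟩ := exists_norm_lt_eDist_lt (n1 + n2) hε
  by_cases hr0 : r = 0
  · exact ⟨z, ⟨hzX, hzM⟩, γ, le_rfl, hη' _ _ (by simpa [hr0] using hη)⟩
  have hint : z + r ∈ interior X := by
    have h := hstrict z hzX (z + (2 : ℝ) • r) (hr z hzX 2 (by norm_num))
      (by simpa using hr0) (1 / 2) (by norm_num) (by norm_num)
    convert h using 1
    module
  obtain ⟨δ, hδ, hball⟩ := Metric.isOpen_iff.1 isOpen_interior _ hint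
  obtain ⟨lam, hlam, p, hp⟩ :=
    exists_smul_near_int r (lt_min hδ hη) (max γ 1) (zero_le_one.trans (le_max_right _ _))
  have hdiff : z + (fun i => (p i : ℝ)) - (z + lam • r) = (fun i => (p i : ℝ)) - lam • r :=
    add_sub_add_left_eq_sub _ _ _
  refine ⟨z + fun i => (p i : ℝ), ⟨?_, fun i hi => ?_⟩, lam, (le_max_left _ _).trans hlam,
    hη' _ _ (hdiff ▸ hp.trans_le (min_le_right _ _))⟩
  · have hmem : z + r + ((fun i => (p i : ℝ)) - lam • r) ∈ X :=
      interior_subset (hball (by simpa using hp.trans_le (min_le_left _ _)))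
    convert hr _ hmem (lam - 1) (sub_nonneg.2 ((le_max_right _ _).trans hlam)) using 1
    module
  · obtain ⟨k, hk⟩ := hzM i hi
    exact ⟨k + p i, by simp [hk]⟩
end

section
/- Every closed convex set X ⊆ ℝ^{n₁+n₂} whose recession cone is generated by vectors of the mixed-lattice, i.e., rec(X) equals the set of all finite nonnegative combinations of elements of some subset R ⊆ ℤ^{n₁} × ℝ^{n₂}, is a Dirichlet convex set with respect to ℤ^{n₁} × ℝ^{n₂}. -/
/-- Simultaneous Dirichlet approximation: some arbitrarily large natural multiple of `a` is
uniformly close to an integer vector. -/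
theorem exists_nat_ge_abs_mul_sub_round_lt {ι : Type*} [Fintype ι] (a : ι → ℝ) {δ : ℝ}
    (hδ : 0 < δ) (m : ℕ) :
    ∃ N ≥ m, ∀ i, |N * a i - round (N * a i)| < δ := by
  have hcluster := mapClusterPt_zero_atTop_nsmul (fun i => (a i : UnitAddCircle))
  obtain ⟨N, hN, hball⟩ := Filter.frequently_atTop.mp
    (hcluster.frequently (Metric.ball_mem_nhds 0 hδ)) m
  refine ⟨N, hN, fun i => ?_⟩
  rw [dist_zero_right, pi_norm_lt_iff hδ] at hball
  have h := hball i
  rwa [Pi.smul_apply, ← AddCircle.coe_nsmul, UnitAddCircle.norm_eq, nsmul_eq_mul] at h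

theorem add_sum_int_smul_mem_Zmix {n1 n2 : ℕ} {ι : Type*} [Fintype ι]
    {z : Fin (n1 + n2) → ℝ} (hz : z ∈ Zmix n1 n2) {u : ι → Fin (n1 + n2) → ℝ}
    (hu : ∀ i, u i ∈ Zmix n1 n2) (c : ι → ℤ) :
    z + ∑ i, (c i : ℝ) • u i ∈ Zmix n1 n2 := by
  intro j hj
  obtain ⟨p, hp⟩ := hz j hj
  choose q hq using fun i => hu i j hj
  exact ⟨p + ∑ i, c i * q i, by simp [hp, hq]⟩

theorem exists_pos_eDist_add_sum_smul_lt {n : ℕ} {ι : Type*} [Fintype ι]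
    (u : ι → Fin n → ℝ) {ε : ℝ} (hε : 0 < ε) :
    ∃ δ > 0, ∀ (x : Fin n → ℝ) (b c : ι → ℝ), (∀ i, |b i - c i| < δ) →
      eDist (x + ∑ i, c i • u i) (x + ∑ i, b i • u i) < ε := by
  have hcont : Continuous fun d : ι → ℝ => eDist (∑ i, d i • u i) 0 := by
    unfold eDist
    fun_prop
  obtain ⟨δ, hδ, h⟩ := Metric.continuous_iff.mp hcont 0 ε hε
  refine ⟨δ, hδ, fun x b c hbc => ?_⟩
  have hd := h (c - b) (by
    rw [dist_zero_right, pi_norm_lt_iff hδ]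
    intro i
    rw [Pi.sub_apply, Real.norm_eq_abs, abs_sub_comm]
    exact hbc i)
  have hlt := (le_abs_self _).trans_lt hd
  simpa [eDist, sub_smul, sub_mul, Finset.sum_sub_distrib] using hlt

theorem recCone_mixedLattice_generated_isDirichlet {n1 n2 : ℕ}
    (X : Set (Fin (n1 + n2) → ℝ)) (hXcl : IsClosed X) (hXconv : Convex ℝ X)
    (R : Set (Fin (n1 + n2) → ℝ)) (hR : R ⊆ Zmix n1 n2)
    (hrec : recCone X = {v | ∃ (k : ℕ) (u : Fin k → Fin (n1 + n2) → ℝ)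
      (a : Fin k → ℝ), (∀ i, u i ∈ R) ∧ (∀ i, 0 ≤ a i) ∧ v = ∑ i, a i • u i}) :
    IsDirichletConvex (Zmix n1 n2) X := by
  refine ⟨hXconv, ?_⟩
  rintro z ⟨hzX, hzM⟩ r hr ε hε γ -
  rw [hrec] at hr
  obtain ⟨k, u, a, hu, ha, rfl⟩ := hr
  obtain ⟨δ, hδ, hdist⟩ := exists_pos_eDist_add_sum_smul_lt u hε
  obtain ⟨N, hN, happrox⟩ := exists_nat_ge_abs_mul_sub_round_lt a hδ ⌈γ⌉₊
  set c : Fin k → ℤ := fun i => round (N * a i)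
  have hc : ∀ i, 0 ≤ (c i : ℝ) := fun i => by
    have : 0 ≤ (N : ℝ) * a i := mul_nonneg N.cast_nonneg (ha i)
    simp only [c, round_eq]
    exact_mod_cast Int.floor_nonneg.mpr (by linarith)
  have hmem : ∑ i, (c i : ℝ) • u i ∈ recCone X := by
    rw [hrec]
    exact ⟨k, u, fun i => c i, hu, hc, rfl⟩
  refine ⟨z + ∑ i, (c i : ℝ) • u i, ⟨?_, ?_⟩, N, (Nat.le_ceil γ).trans (by exact_mod_cast hN), ?_⟩
  · simpa using hmem z hzX 1 zero_le_one
  · exact add_sum_int_smul_mem_Zmix hzM (fun i => hR (hu i)) c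
  · simpa only [Finset.smul_sum, smul_smul] using
      hdist z (fun i => N * a i) (fun i => c i) happrox
end

section
/- Let M ⊆ ℝ^n be a mixed-lattice, let P ⊆ ℝ^n be a Dirichlet convex set with respect to M, and let S = P ∩ M. Let Q ⊆ ℝ^n be a full-dimensional maximal S-free convex set, and let r ∈ rec(P) ∩ rec(Q). Then −r ∈ rec(Q). -/
theorem dist_le_eDist {n : ℕ} (u v : Fin n → ℝ) : dist u v ≤ eDist u v := by
  refine (dist_pi_le_iff (Real.sqrt_nonneg _)).2 fun i => Real.le_sqrt_of_sq_le ?_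
  rw [Real.dist_eq, sq_abs]
  exact Finset.single_le_sum (f := fun i => (u i - v i) ^ 2)
    (fun j _ => sq_nonneg _) (Finset.mem_univ i)

theorem recCone_subset_recCone_interior {n : ℕ} (X : Set (Fin n → ℝ)) :
    recCone X ⊆ recCone (interior X) := by
  intro r hr x hx t ht
  have hopen : IsOpen ((fun y => y - t • r) ⁻¹' interior X) :=
    isOpen_interior.preimage (by fun_prop)
  refine interior_maximal ?_ hopen (by simpa using hx)
  intro y hy
  simpa using hr _ (interior_subset hy) t ht

/-- The sum of a set `X` and the line spanned by `r`. -/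
def lineHull {n : ℕ} (X : Set (Fin n → ℝ)) (r : Fin n → ℝ) : Set (Fin n → ℝ) :=
  {x | ∃ s : ℝ, x + s • r ∈ X}

theorem subset_lineHull {n : ℕ} (X : Set (Fin n → ℝ)) (r : Fin n → ℝ) :
    X ⊆ lineHull X r := fun x hx => ⟨0, by simpa using hx⟩

theorem Convex.lineHull {n : ℕ} {X : Set (Fin n → ℝ)} (hX : Convex ℝ X) (r : Fin n → ℝ) :
    Convex ℝ (lineHull X r) := by
  rintro x ⟨s, hs⟩ y ⟨t, ht⟩ a b ha hb hab
  refine ⟨a * s + b * t, ?_⟩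
  convert hX hs ht ha hb hab using 1
  module

theorem Convex.interior_lineHull_subset {n : ℕ} {X : Set (Fin n → ℝ)} (hX : Convex ℝ X)
    (hne : (interior X).Nonempty) (r : Fin n → ℝ) :
    interior (_root_.lineHull X r) ⊆ _root_.lineHull (interior X) r := by
  obtain ⟨q, hq⟩ := hne
  intro z hz
  have hlim : Filter.Tendsto (fun t : ℝ => z + t • (z - q)) (nhdsWithin 0 (Set.Ioi 0))
      (nhds z) := by
    have hcont : Continuous fun t : ℝ => z + t • (z - q) := by fun_prop
    simpa using (hcont.tendsto 0).mono_left nhdsWithin_le_nhds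
  obtain ⟨t, ⟨s, hs⟩, ht⟩ :=
    ((hlim.eventually (mem_interior_iff_mem_nhds.1 hz)).and self_mem_nhdsWithin).exists
  have ht : 0 < t := ht
  have h1 : (1 + t) ≠ 0 := by positivity
  refine ⟨s / (1 + t), ?_⟩
  convert hX.combo_self_interior_mem_interior hs hq (a := 1 / (1 + t)) (b := t / (1 + t))
    (by positivity) (by positivity) (by field_simp) using 1
  match_scalars <;> field_simp <;> ring

theorem maximal_Sfree_recession {n : ℕ} (M P Q : Set (Fin n → ℝ))
    (hM : IsMixedLattice M) (hP : IsDirichletConvex M P)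
    (hQconv : Convex ℝ Q) (hQfull : (interior Q).Nonempty)
    (hQfree : interior Q ∩ (P ∩ M) = ∅)
    (hQmax : ∀ Q' : Set (Fin n → ℝ), Convex ℝ Q' → (interior Q').Nonempty →
      interior Q' ∩ (P ∩ M) = ∅ → Q ⊆ Q' → Q' = Q)
    (r : Fin n → ℝ) (hr : r ∈ recCone P ∩ recCone Q) :
    -r ∈ recCone Q := by
  obtain ⟨hrP, hrQ⟩ := hr
  have hfree : interior (lineHull Q r) ∩ (P ∩ M) = ∅ := by
    refine Set.eq_empty_of_forall_notMem ?_
    rintro z ⟨hz, hzS⟩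
    obtain ⟨s, hs⟩ := hQconv.interior_lineHull_subset hQfull r hz
    obtain ⟨ε, hε, hball⟩ := Metric.isOpen_iff.1 isOpen_interior _ hs
    obtain ⟨w, hw, t, ht, hwt⟩ := hP.2 z hzS r hrP ε hε (max s 0) (le_max_right s 0)
    have hst : s ≤ t := (le_max_left s 0).trans ht
    have hmem : w - (t - s) • r ∈ interior Q := by
      apply hball
      rw [Metric.mem_ball]
      refine lt_of_eq_of_lt ?_ ((dist_le_eDist _ _).trans_lt hwt)
      rw [dist_eq_norm, dist_eq_norm]
      congr 1
      module
    have hwQ := recCone_subset_recCone_interior Q hrQ _ hmem (t - s) (sub_nonneg.2 hst)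
    rw [sub_add_cancel] at hwQ
    exact Set.notMem_empty w (hQfree ▸ ⟨hwQ, hw⟩)
  have heq := hQmax (lineHull Q r) (hQconv.lineHull r)
    (hQfull.mono (interior_mono (subset_lineHull Q r))) hfree (subset_lineHull Q r)
  intro x hx t _
  rw [← heq]
  exact ⟨t, by simpa using hx⟩
end

section
/- Let L³ = {x ∈ ℝ³ : √(x₁² + x₂²) ≤ x₃} be the 3-dimensional Lorentz cone. For every ε > 0, the optimization problem inf{x₂ : (x₁, x₂) ∈ ℤ², (x₁, x₂, x₁ + ε) ∈ L³} is unbounded below; in particular, for every negative integer x₂, the point (x₁, x₂) with x₁ = ⌈(x₂² − ε²)/(2ε)⌉ is feasible. -/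
/-!
STATEMENT 18: For every `ε > 0`, the problem
`inf {x₂ : (x₁, x₂) ∈ ℤ², (x₁, x₂, x₁ + ε) ∈ L³}` is unbounded below; in particular,
for every negative integer `x₂`, the point `(x₁, x₂)` with
`x₁ = ⌈(x₂² - ε²) / (2ε)⌉` is feasible. Here `(x₁, x₂, x₁ + ε) ∈ L³` means
`√(x₁² + x₂²) ≤ x₁ + ε`.
-/

/-- A point `(x, y)` with `(y² - ε²) / (2ε) ≤ x` satisfies the perturbed Lorentz cone constraint. -/
theorem sqrt_sq_add_sq_le_add {ε x y : ℝ} (hε : 0 < ε) (h : (y ^ 2 - ε ^ 2) / (2 * ε) ≤ x) :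
    Real.sqrt (x ^ 2 + y ^ 2) ≤ x + ε := by
  have hy : y ^ 2 - ε ^ 2 ≤ x * (2 * ε) := (div_le_iff₀ (by positivity)).1 h
  refine Real.sqrt_le_iff.2 ⟨?_, by nlinarith⟩
  by_contra! hneg
  nlinarith [sq_nonneg y, mul_pos hε hε, mul_pos hε (neg_pos.2 hneg)]

theorem perturbed_lorentz_MIP_unbounded (ε : ℝ) (hε : 0 < ε) :
    (∀ x2 : ℤ, x2 < 0 →
      Real.sqrt (((⌈((x2 : ℝ) ^ 2 - ε ^ 2) / (2 * ε)⌉ : ℤ) : ℝ) ^ 2 + (x2 : ℝ) ^ 2) ≤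
        ((⌈((x2 : ℝ) ^ 2 - ε ^ 2) / (2 * ε)⌉ : ℤ) : ℝ) + ε) ∧
    ¬ BddBelow {v : ℝ | ∃ x1 x2 : ℤ,
      Real.sqrt ((x1 : ℝ) ^ 2 + (x2 : ℝ) ^ 2) ≤ (x1 : ℝ) + ε ∧ v = (x2 : ℝ)} := by
  refine ⟨fun x2 _ => sqrt_sq_add_sq_le_add hε (Int.le_ceil _), ?_⟩
  rintro ⟨b, hb⟩
  obtain ⟨n, hn⟩ := exists_int_lt b
  exact hn.not_ge (hb ⟨_, n, sqrt_sq_add_sq_le_add hε (Int.le_ceil _), rfl⟩)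
end
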